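/- arXiv:1003.5859 — 12 statements merged into one kernel-verified Lean document; each statement's English description precedes it below -/
import Mathlib

section
/- Let x be an ADHM datum for ℙ¹ over k = ℂ. Then the following are equivalent: (1) x is stable; (2) for every z ∈ ℂ with z ≠ 0, the orbit GL(V)·(x,z) = { (g·x, det(g)⁻¹ z) : g ∈ GL(V) } is a closed subset of B̃ × ℂ; (3) there exists z ∈ ℂ with z ≠ 0 such that the orbit GL(V)·(x,z) is a closed subset of B̃ × ℂ. Here B̃ × ℂ carries its standard topology as a finite-dimensional complex vector space. -/
open Matrix

/-- The space `B̃` of ADHM tuples for `ℙ¹` (with `V = ℂⁿ`, `W = ℂᵐ`), written in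
coordinates: `x.1 k l` is the coefficient of `x_l` in `B̃_{k+1}`, `x.2.1 l` the
coefficient of `x_l` in `ĩ`, and `x.2.2 l` the coefficient of `x_l` in `j̃`. -/
abbrev ADHMSpace (n m : ℕ) :=
  (Fin 2 → Fin 2 → Matrix (Fin n) (Fin n) ℂ) ×
  (Fin 2 → Matrix (Fin n) (Fin m) ℂ) ×
  (Fin 2 → Matrix (Fin m) (Fin n) ℂ)

/-- The ADHM equations `[B̃₁, B̃₂] + ĩ j̃ = 0`, written out in the coefficients of
`x₀²`, `x₀x₁` and `x₁²`. -/
def ADHMEq {n m : ℕ} (x : ADHMSpace n m) : Prop :=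
  x.1 0 0 * x.1 1 0 - x.1 1 0 * x.1 0 0 + x.2.1 0 * x.2.2 0 = 0 ∧
  x.1 0 0 * x.1 1 1 - x.1 1 1 * x.1 0 0 + x.1 0 1 * x.1 1 0 - x.1 1 0 * x.1 0 1
      + x.2.1 0 * x.2.2 1 + x.2.1 1 * x.2.2 0 = 0 ∧
  x.1 0 1 * x.1 1 1 - x.1 1 1 * x.1 0 1 + x.2.1 1 * x.2.2 1 = 0

/-- Stability of an ADHM datum for `ℙ¹`: no proper subspace `S ⊊ V` which is invariant
under all four `B`-components contains the images of both `i`-components. -/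
def ADHMStable {n m : ℕ} (x : ADHMSpace n m) : Prop :=
  ∀ S : Submodule ℂ (Fin n → ℂ), S ≠ ⊤ →
    (∀ k l : Fin 2, S.map (Matrix.toLin' (x.1 k l)) ≤ S) →
    ¬(LinearMap.range (Matrix.toLin' (x.2.1 0)) ≤ S ∧
      LinearMap.range (Matrix.toLin' (x.2.1 1)) ≤ S)

/-- The action of `g ∈ GL(V)` on `B̃`: `g · (B, i, j) = (g B g⁻¹, g i, j g⁻¹)`. -/
noncomputable def ADHMAct {n m : ℕ} (g : (Matrix (Fin n) (Fin n) ℂ)ˣ) (x : ADHMSpace n m) :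
    ADHMSpace n m :=
  (fun k l => (g : Matrix (Fin n) (Fin n) ℂ) * x.1 k l * ((g⁻¹ : (Matrix (Fin n) (Fin n) ℂ)ˣ) : Matrix (Fin n) (Fin n) ℂ),
   fun l => (g : Matrix (Fin n) (Fin n) ℂ) * x.2.1 l,
   fun l => x.2.2 l * ((g⁻¹ : (Matrix (Fin n) (Fin n) ℂ)ˣ) : Matrix (Fin n) (Fin n) ℂ))

/-- The vector obtained by applying a word in the endomorphisms of `x` to a column of one of
the two maps `i₀`, `i₁`. -/
def ADHMWord {n m : ℕ} (x : ADHMSpace n m) (w : List (Fin 2 × Fin 2) × Fin 2 × Fin m) :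
    Fin n → ℂ :=
  (w.1.map fun q => x.1 q.1 q.2).prod *ᵥ (x.2.1 w.2.1).col w.2.2

theorem continuous_ADHMWord {n m : ℕ} (w : List (Fin 2 × Fin 2) × Fin 2 × Fin m) :
    Continuous fun x : ADHMSpace n m => ADHMWord x w := by
  have hcol : Continuous fun x : ADHMSpace n m => (x.2.1 w.2.1).col w.2.2 :=
    continuous_pi fun i => (by fun_prop : Continuous fun x : ADHMSpace n m => x.2.1 w.2.1)
      |>.matrix_elem i w.2.2
  refine Continuous.matrix_mulVec (continuous_list_prod _ fun q _ => ?_) hcol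
  fun_prop

theorem list_prod_map_conj {M ι : Type*} [Monoid M] (g : Mˣ) (f : ι → M) (l : List ι) :
    (l.map fun q => (g : M) * f q * ((g⁻¹ : Mˣ) : M)).prod =
      (g : M) * (l.map f).prod * ((g⁻¹ : Mˣ) : M) := by
  induction l with
  | nil => simp
  | cons a l ih =>
    rw [List.map_cons, List.prod_cons, ih]
    simp [mul_assoc]

theorem ADHMWord_act {n m : ℕ} (g : (Matrix (Fin n) (Fin n) ℂ)ˣ) (x : ADHMSpace n m)
    (w : List (Fin 2 × Fin 2) × Fin 2 × Fin m) :
    ADHMWord (ADHMAct g x) w = (g : Matrix (Fin n) (Fin n) ℂ) *ᵥ ADHMWord x w := by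
  have hcol : ((g : Matrix (Fin n) (Fin n) ℂ) * x.2.1 w.2.1).col w.2.2 =
      (g : Matrix (Fin n) (Fin n) ℂ) *ᵥ (x.2.1 w.2.1).col w.2.2 := by
    ext i
    simp [Matrix.mul_apply, Matrix.mulVec, dotProduct]
  simp only [ADHMWord, ADHMAct]
  rw [list_prod_map_conj g (fun q : Fin 2 × Fin 2 => x.1 q.1 q.2), hcol]
  simp only [Matrix.mulVec_mulVec, mul_assoc]
  rw [Units.inv_mul, mul_one]

theorem ADHMStable.span_ADHMWord {n m : ℕ} {x : ADHMSpace n m} (h : ADHMStable x) :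
    Submodule.span ℂ (Set.range (ADHMWord x)) = ⊤ := by
  by_contra hne
  have hi (l : Fin 2) :
      LinearMap.range (Matrix.toLin' (x.2.1 l)) ≤ Submodule.span ℂ (Set.range (ADHMWord x)) := by
    rw [Matrix.range_toLin', Submodule.span_le]
    rintro _ ⟨c, rfl⟩
    exact Submodule.subset_span ⟨([], l, c), by simp [ADHMWord]⟩
  refine h _ hne (fun k l => ?_) ⟨hi 0, hi 1⟩
  rw [Submodule.map_span, Submodule.span_le]
  rintro _ ⟨_, ⟨w, rfl⟩, rfl⟩
  exact Submodule.subset_span ⟨((k, l) :: w.1, w.2), by simp [ADHMWord]⟩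

/-- For a stable datum `x`, the element `g` can be recovered continuously from `g · x`. -/
theorem ADHMStable.exists_continuous_section {n m : ℕ} {x : ADHMSpace n m} (h : ADHMStable x) :
    ∃ F : ADHMSpace n m → Matrix (Fin n) (Fin n) ℂ, Continuous F ∧
      ∀ g : (Matrix (Fin n) (Fin n) ℂ)ˣ, F (ADHMAct g x) = g := by
  have hc (k : Fin n) : ∃ c : (List (Fin 2 × Fin 2) × Fin 2 × Fin m) →₀ ℂ,
      (c.sum fun w a => a • ADHMWord x w) = Pi.single k 1 :=
    Finsupp.mem_span_range_iff_exists_finsupp.1 (h.span_ADHMWord ▸ Submodule.mem_top)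
  choose c hc using hc
  refine ⟨fun y => Matrix.of fun i k => ((c k).sum fun w a => a • ADHMWord y w) i, ?_, ?_⟩
  · refine continuous_matrix fun i k => ?_
    refine (continuous_apply i).comp ?_
    exact continuous_finsetSum _ fun w _ => (continuous_ADHMWord w).const_smul (c k w)
  · intro g
    ext i k
    have hg : ((c k).sum fun w a => a • ADHMWord (ADHMAct g x) w) =
        (g : Matrix (Fin n) (Fin n) ℂ) *ᵥ Pi.single k 1 := by
      simp only [← hc k, Finsupp.sum, Matrix.mulVec_sum, Matrix.mulVec_smul, ADHMWord_act]
    change ((c k).sum fun w a => a • ADHMWord (ADHMAct g x) w) i = _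
    rw [hg]
    simp

theorem ADHMStable.isClosed_orbit {n m : ℕ} {x : ADHMSpace n m} (h : ADHMStable x) {z : ℂ}
    (hz : z ≠ 0) :
    IsClosed {p : ADHMSpace n m × ℂ | ∃ g : (Matrix (Fin n) (Fin n) ℂ)ˣ,
      p = (ADHMAct g x, ((g : Matrix (Fin n) (Fin n) ℂ).det)⁻¹ * z)} := by
  obtain ⟨F, hF, hFg⟩ := h.exists_continuous_section
  have key : {p : ADHMSpace n m × ℂ | ∃ g : (Matrix (Fin n) (Fin n) ℂ)ˣ,
      p = (ADHMAct g x, ((g : Matrix (Fin n) (Fin n) ℂ).det)⁻¹ * z)} =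
      {p | (F p.1).det * p.2 = z} ∩ {p | ∀ k l, F p.1 * x.1 k l = p.1.1 k l * F p.1} ∩
        {p | ∀ l, F p.1 * x.2.1 l = p.1.2.1 l} ∩ {p | ∀ l, x.2.2 l = p.1.2.2 l * F p.1} := by
    ext p
    constructor
    · rintro ⟨g, rfl⟩
      have hdet : (g : Matrix (Fin n) (Fin n) ℂ).det ≠ 0 :=
        ((Matrix.isUnit_iff_isUnit_det _).1 g.isUnit).ne_zero
      simp only [Set.mem_inter_iff, Set.mem_ofPred_eq, hFg]
      refine ⟨⟨⟨by field_simp, fun k l => ?_⟩, fun l => rfl⟩, fun l => ?_⟩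
      · simp [ADHMAct, mul_assoc]
      · simp [ADHMAct, Matrix.mul_assoc]
    · rintro ⟨⟨⟨hdet, hB⟩, hi⟩, hj⟩
      simp only [Set.mem_ofPred_eq] at hdet hB hi hj
      have hd : (F p.1).det ≠ 0 := by
        intro h0
        rw [h0, zero_mul] at hdet
        exact hz hdet.symm
      obtain ⟨g, hg⟩ := (Matrix.isUnit_iff_isUnit_det _).2 (isUnit_iff_ne_zero.2 hd)
      rw [← hg] at hdet hB hi hj hd
      refine ⟨g, Prod.ext (Prod.ext ?_ (Prod.ext ?_ ?_)) ?_⟩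
      · funext k l
        simp [ADHMAct, hB, mul_assoc]
      · funext l
        simp [ADHMAct, hi]
      · funext l
        simp [ADHMAct, hj, Matrix.mul_assoc]
      · rw [← hdet]
        field_simp
  rw [key]
  have hFfst : Continuous fun p : ADHMSpace n m × ℂ => F p.1 := hF.comp continuous_fst
  refine ((IsClosed.inter ?_ ?_).inter ?_).inter ?_
  · exact isClosed_eq (hFfst.matrix_det.mul continuous_snd) continuous_const
  · simp only [Set.ofPred_forall]
    exact isClosed_iInter fun k => isClosed_iInter fun l =>
      isClosed_eq (hFfst.matrix_mul continuous_const)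
        (Continuous.matrix_mul (by fun_prop) hFfst)
  · simp only [Set.ofPred_forall]
    exact isClosed_iInter fun l => isClosed_eq (hFfst.matrix_mul continuous_const) (by fun_prop)
  · simp only [Set.ofPred_forall]
    exact isClosed_iInter fun l => isClosed_eq continuous_const
      (Continuous.matrix_mul (by fun_prop) hFfst)

/-- A datum that is not stable is compatible with a proper projection, onto a destabilizing
subspace. -/
theorem exists_projection_of_not_ADHMStable {n m : ℕ} {x : ADHMSpace n m} (h : ¬ADHMStable x) :
    ∃ P : Matrix (Fin n) (Fin n) ℂ, P * P = P ∧ P.det = 0 ∧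
      (∀ k l, P * x.1 k l * P = x.1 k l * P) ∧ ∀ l, P * x.2.1 l = x.2.1 l := by
  simp only [ADHMStable, not_forall, not_not] at h
  obtain ⟨S, hS, hB, hi⟩ := h
  obtain ⟨f, hf⟩ := LinearMap.exists_leftInverse_of_injective S.subtype S.ker_subtype
  have hfix (v : Fin n → ℂ) (hv : v ∈ S) : (S.subtype ∘ₗ f).toMatrix' *ᵥ v = v := by
    rw [LinearMap.toMatrix'_mulVec]
    exact congrArg Subtype.val (LinearMap.congr_fun hf ⟨v, hv⟩)
  have hmem (v : Fin n → ℂ) : (S.subtype ∘ₗ f).toMatrix' *ᵥ v ∈ S := by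
    rw [LinearMap.toMatrix'_mulVec]
    exact (f v).2
  refine ⟨(S.subtype ∘ₗ f).toMatrix', ?_, ?_, fun k l => ?_, fun l => ?_⟩
  · refine Matrix.ext_of_mulVec_single fun i => ?_
    rw [← Matrix.mulVec_mulVec]
    exact hfix _ (hmem _)
  · by_contra hdet
    refine hS (eq_top_iff.2 fun v _ => ?_)
    have hv := hmem ((S.subtype ∘ₗ f).toMatrix'⁻¹ *ᵥ v)
    rwa [Matrix.mulVec_mulVec, Matrix.mul_nonsing_inv _ (isUnit_iff_ne_zero.2 hdet),
      Matrix.one_mulVec] at hv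
  · refine Matrix.ext_of_mulVec_single fun i => ?_
    rw [mul_assoc, ← Matrix.mulVec_mulVec, ← Matrix.mulVec_mulVec]
    exact hfix _ (hB k l ⟨_, hmem _, Matrix.toLin'_apply _ _⟩)
  · refine Matrix.ext_of_mulVec_single fun i => ?_
    rw [← Matrix.mulVec_mulVec]
    refine hfix _ ?_
    have hl : LinearMap.range (Matrix.toLin' (x.2.1 l)) ≤ S := by
      fin_cases l
      exacts [hi.1, hi.2]
    exact hl ⟨_, Matrix.toLin'_apply _ _⟩

theorem not_isClosed_orbit_of_not_ADHMStable {n m : ℕ} {x : ADHMSpace n m} (h : ¬ADHMStable x)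
    {z : ℂ} (hz : z ≠ 0) :
    ¬IsClosed {p : ADHMSpace n m × ℂ | ∃ g : (Matrix (Fin n) (Fin n) ℂ)ˣ,
      p = (ADHMAct g x, ((g : Matrix (Fin n) (Fin n) ℂ).det)⁻¹ * z)} := by
  intro hcl
  obtain ⟨P, hPP, hdet, hB, hi⟩ := exists_projection_of_not_ADHMStable h
  let A : ℂ → Matrix (Fin n) (Fin n) ℂ := fun s => P + s • (1 - P)
  have hA : Continuous A := by fun_prop
  have hmul (s t : ℂ) : A s * A t = A (s * t) := by
    have hPQ : P * (1 - P) = 0 := by rw [mul_sub, mul_one, hPP, sub_self]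
    have hQP : (1 - P) * P = 0 := by rw [sub_mul, one_mul, hPP, sub_self]
    have hQQ : (1 - P) * (1 - P) = 1 - P := by rw [sub_mul, one_mul, hPQ, sub_zero]
    simp only [A, mul_add, add_mul, smul_mul_assoc, mul_smul_comm, hPP, hPQ, hQP, hQQ,
      smul_zero, add_zero, zero_add, smul_smul, mul_comm t s]
  have hA1 : A 1 = 1 := by simp [A]
  let φ : ℂ → ADHMSpace n m × ℂ := fun s =>
    ((fun k l => x.1 k l * P + (1 - P) * x.1 k l * (1 - P) + s • (P * x.1 k l * (1 - P)),
      x.2.1, fun l => x.2.2 l * A s), (A s).det * z)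
  have hφ : Continuous φ := by
    refine .prodMk (.prodMk ?_ (.prodMk continuous_const ?_)) ?_
    · fun_prop
    · exact continuous_pi fun l => continuous_const.matrix_mul hA
    · exact hA.matrix_det.mul continuous_const
  have horbit (s : ℂ) (hs : s ≠ 0) : φ s ∈ {p : ADHMSpace n m × ℂ |
      ∃ g : (Matrix (Fin n) (Fin n) ℂ)ˣ,
        p = (ADHMAct g x, ((g : Matrix (Fin n) (Fin n) ℂ).det)⁻¹ * z)} := by
    refine ⟨⟨A s⁻¹, A s, by rw [hmul, inv_mul_cancel₀ hs, hA1],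
      by rw [hmul, mul_inv_cancel₀ hs, hA1]⟩, ?_⟩
    refine Prod.ext (Prod.ext ?_ (Prod.ext ?_ ?_)) ?_
    · funext k l
      have hQB : (1 - P) * x.1 k l * P = 0 := by
        rw [sub_mul, sub_mul, one_mul, hB, sub_self]
      change _ = A s⁻¹ * x.1 k l * A s
      simp only [φ, A, add_mul, mul_add, smul_mul_assoc, mul_smul_comm, smul_add, smul_smul, hQB,
        hB, smul_zero, mul_inv_cancel₀ hs, one_smul]
      abel
    · funext l
      change _ = A s⁻¹ * x.2.1 l
      simp only [φ, A, Matrix.smul_mul, Matrix.sub_mul, Matrix.add_mul, hi,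
        Matrix.one_mul, sub_self, smul_zero, add_zero]
    · rfl
    · have hd : (A s⁻¹).det * (A s).det = 1 := by
        rw [← Matrix.det_mul, hmul, inv_mul_cancel₀ hs, hA1, Matrix.det_one]
      change (A s).det * z = (A s⁻¹).det⁻¹ * z
      rw [eq_inv_of_mul_eq_one_right hd]
  have hmem : φ 0 ∈ {p : ADHMSpace n m × ℂ | ∃ g : (Matrix (Fin n) (Fin n) ℂ)ˣ,
      p = (ADHMAct g x, ((g : Matrix (Fin n) (Fin n) ℂ).det)⁻¹ * z)} := by
    have hsub : closure ({0}ᶜ : Set ℂ) ⊆ φ ⁻¹' {p : ADHMSpace n m × ℂ |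
        ∃ g : (Matrix (Fin n) (Fin n) ℂ)ˣ,
          p = (ADHMAct g x, ((g : Matrix (Fin n) (Fin n) ℂ).det)⁻¹ * z)} :=
      closure_minimal (fun s hs => horbit s hs) (hcl.preimage hφ)
    exact hsub (by rw [(dense_compl_singleton (0 : ℂ)).closure_eq]; trivial)
  obtain ⟨g, hg⟩ := hmem
  have hg2 : (A 0).det * z = (g : Matrix (Fin n) (Fin n) ℂ).det⁻¹ * z := congrArg Prod.snd hg
  have hg0 : (g : Matrix (Fin n) (Fin n) ℂ).det ≠ 0 :=
    ((Matrix.isUnit_iff_isUnit_det _).1 g.isUnit).ne_zero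
  simp only [A, zero_smul, add_zero, hdet, zero_mul] at hg2
  exact mul_ne_zero (inv_ne_zero hg0) hz hg2.symm

/-- for an ADHM datum `x` for `ℙ¹` over `ℂ`, stability is equivalent to
closedness of the `GL(V)`-orbit of `(x, z)` for all `z ≠ 0`, and also to closedness of
this orbit for some `z ≠ 0`. -/
theorem ADHMStable_iff_orbit_closed {n m : ℕ} (x : ADHMSpace n m) (hx : ADHMEq x) :
    (ADHMStable x ↔ ∀ z : ℂ, z ≠ 0 →
      IsClosed {p : ADHMSpace n m × ℂ | ∃ g : (Matrix (Fin n) (Fin n) ℂ)ˣ,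
        p = (ADHMAct g x, ((g : Matrix (Fin n) (Fin n) ℂ).det)⁻¹ * z)}) ∧
    (ADHMStable x ↔ ∃ z : ℂ, z ≠ 0 ∧
      IsClosed {p : ADHMSpace n m × ℂ | ∃ g : (Matrix (Fin n) (Fin n) ℂ)ˣ,
        p = (ADHMAct g x, ((g : Matrix (Fin n) (Fin n) ℂ).det)⁻¹ * z)}) := by
  have hclosed : ADHMStable x → ∀ z : ℂ, z ≠ 0 →
      IsClosed {p : ADHMSpace n m × ℂ | ∃ g : (Matrix (Fin n) (Fin n) ℂ)ˣ,
        p = (ADHMAct g x, ((g : Matrix (Fin n) (Fin n) ℂ).det)⁻¹ * z)} :=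
    fun h z hz => h.isClosed_orbit hz
  have hstable : (∃ z : ℂ, z ≠ 0 ∧
      IsClosed {p : ADHMSpace n m × ℂ | ∃ g : (Matrix (Fin n) (Fin n) ℂ)ˣ,
        p = (ADHMAct g x, ((g : Matrix (Fin n) (Fin n) ℂ).det)⁻¹ * z)}) → ADHMStable x := by
    rintro ⟨z, hz, hcl⟩
    by_contra h
    exact not_isClosed_orbit_of_not_ADHMStable h hz hcl
  exact ⟨⟨hclosed, fun h => hstable ⟨1, one_ne_zero, h 1 one_ne_zero⟩⟩,
    ⟨fun h => ⟨1, one_ne_zero, hclosed h 1 one_ne_zero⟩, hstable⟩⟩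
end

section
/- Let x be an ADHM datum for ℙ¹ over k = ℂ. Then x is stable if and only if there exist an integer n ≥ 1 and a polynomial function f : B̃ → ℂ such that f(g·y) = det(g)ⁿ · f(y) for all g ∈ GL(V) and all y ∈ B̃, and f(x) ≠ 0. (Equivalently: stability of x coincides with GIT semistability of x with respect to the character det of GL(V).) -/
open Matrix

/-- The index set of the natural coordinates on `B̃`. -/
abbrev ADHMCoordIdx (n m : ℕ) :=
  (Fin 2 × Fin 2 × Fin n × Fin n) ⊕ (Fin 2 × Fin n × Fin m) ⊕ (Fin 2 × Fin m × Fin n)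

/-- The coordinates of a point of `B̃`. -/
def ADHMCoords {n m : ℕ} (x : ADHMSpace n m) : ADHMCoordIdx n m → ℂ
  | Sum.inl (k, l, a, b) => x.1 k l a b
  | Sum.inr (Sum.inl (l, a, b)) => x.2.1 l a b
  | Sum.inr (Sum.inr (l, a, b)) => x.2.2 l a b

/-- The matrix whose column `c` is the column `a` of `B_w * i_l`, where `s c = (w, l, a)` and `B_w`
is the product of the matrices `B` along the word `w`. -/
def wordMatrix {R : Type*} [CommRing R] {n m : ℕ} (B : Fin 2 → Fin 2 → Matrix (Fin n) (Fin n) R)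
    (i : Fin 2 → Matrix (Fin n) (Fin m) R)
    (s : Fin n → List (Fin 2 × Fin 2) × Fin 2 × Fin m) : Matrix (Fin n) (Fin n) R :=
  Matrix.of fun r c =>
    (((s c).1.map fun p => B p.1 p.2).prod * i (s c).2.1) r (s c).2.2

theorem wordMatrix_map {R R' : Type*} [CommRing R] [CommRing R'] (φ : R →+* R') {n m : ℕ}
    (B : Fin 2 → Fin 2 → Matrix (Fin n) (Fin n) R) (i : Fin 2 → Matrix (Fin n) (Fin m) R)
    (s : Fin n → List (Fin 2 × Fin 2) × Fin 2 × Fin m) :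
    (wordMatrix B i s).map φ =
      wordMatrix (fun k l => (B k l).map φ) (fun l => (i l).map φ) s := by
  ext r c
  have h : ((((s c).1.map fun p => B p.1 p.2).prod).map φ) =
      ((s c).1.map fun p => (B p.1 p.2).map φ).prod := by
    have := map_list_prod (RingHom.mapMatrix (m := Fin n) φ) ((s c).1.map fun p => B p.1 p.2)
    simpa [Function.comp_def] using this
  simp only [wordMatrix, Matrix.map_apply, Matrix.of_apply, ← h, ← Matrix.map_mul]

theorem prod_map_conj {M ι : Type*} [Monoid M] (g : Mˣ) (B : ι → M) (w : List ι) :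
    (w.map fun p => (g : M) * B p * ((g⁻¹ : Mˣ) : M)).prod =
      g * (w.map B).prod * ((g⁻¹ : Mˣ) : M) := by
  induction w with
  | nil => simp
  | cons p w ih =>
    rw [List.map_cons, List.prod_cons, ih, List.map_cons, List.prod_cons]
    simp [mul_assoc]

theorem wordMatrix_ADHMAct {n m : ℕ} (g : (Matrix (Fin n) (Fin n) ℂ)ˣ) (y : ADHMSpace n m)
    (s : Fin n → List (Fin 2 × Fin 2) × Fin 2 × Fin m) :
    wordMatrix (ADHMAct g y).1 (ADHMAct g y).2.1 s =
      (g : Matrix (Fin n) (Fin n) ℂ) * wordMatrix y.1 y.2.1 s := by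
  ext r c
  have h := prod_map_conj g (fun p : Fin 2 × Fin 2 => y.1 p.1 p.2) (s c).1
  simp only [wordMatrix, ADHMAct, Matrix.of_apply, h]
  rw [Matrix.mul_assoc, ← Matrix.mul_assoc _ (g : Matrix (Fin n) (Fin n) ℂ), Units.inv_mul,
    Matrix.one_mul, Matrix.mul_assoc]
  simp [Matrix.mul_apply (M := (g : Matrix (Fin n) (Fin n) ℂ))]

/-- The determinant of `wordMatrix`, as a polynomial on `B̃`. -/
noncomputable def wordPoly {n m : ℕ} (s : Fin n → List (Fin 2 × Fin 2) × Fin 2 × Fin m) :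
    MvPolynomial (ADHMCoordIdx n m) ℂ :=
  (wordMatrix (fun k l => Matrix.of fun a b => MvPolynomial.X (Sum.inl (k, l, a, b)))
    (fun l => Matrix.of fun a b => MvPolynomial.X (Sum.inr (Sum.inl (l, a, b)))) s).det

theorem eval_wordPoly {n m : ℕ} (s : Fin n → List (Fin 2 × Fin 2) × Fin 2 × Fin m)
    (y : ADHMSpace n m) :
    MvPolynomial.eval (ADHMCoords y) (wordPoly s) = (wordMatrix y.1 y.2.1 s).det := by
  rw [wordPoly, RingHom.map_det, RingHom.mapMatrix_apply, wordMatrix_map]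
  congr 2 <;> ext <;> simp [ADHMCoords]

theorem span_words_eq_top {n m : ℕ} {x : ADHMSpace n m} (hx : ADHMStable x) :
    Submodule.span ℂ (Set.range fun (q : List (Fin 2 × Fin 2) × Fin 2 × Fin m) (r : Fin n) =>
      ((q.1.map fun p => x.1 p.1 p.2).prod * x.2.1 q.2.1) r q.2.2) = ⊤ := by
  by_contra hS
  refine hx _ hS (fun k l => ?_) ?_
  · rw [Submodule.map_span, Submodule.span_le]
    rintro _ ⟨_, ⟨⟨w, l', a⟩, rfl⟩, rfl⟩
    refine Submodule.subset_span ⟨((k, l) :: w, l', a), ?_⟩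
    ext r
    simp [Matrix.mul_assoc, Matrix.mul_apply (M := x.1 k l), Matrix.mulVec, dotProduct]
  · have h (l : Fin 2) : LinearMap.range (Matrix.toLin' (x.2.1 l)) ≤
        Submodule.span ℂ (Set.range fun (q : List (Fin 2 × Fin 2) × Fin 2 × Fin m) (r : Fin n) =>
          ((q.1.map fun p => x.1 p.1 p.2).prod * x.2.1 q.2.1) r q.2.2) := by
      rw [Matrix.range_toLin', Submodule.span_le]
      rintro _ ⟨a, rfl⟩
      exact Submodule.subset_span ⟨([], l, a), by ext r; simp⟩
    exact ⟨h 0, h 1⟩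

theorem exists_wordMatrix_det_ne_zero {n m : ℕ} {x : ADHMSpace n m} (hx : ADHMStable x) :
    ∃ s, (wordMatrix x.1 x.2.1 s).det ≠ 0 := by
  obtain ⟨κ, a, -, hspan, hli⟩ := exists_linearIndependent' ℂ
    (fun (q : List (Fin 2 × Fin 2) × Fin 2 × Fin m) (r : Fin n) =>
      ((q.1.map fun p => x.1 p.1 p.2).prod * x.2.1 q.2.1) r q.2.2)
  rw [span_words_eq_top hx] at hspan
  let b := Module.Basis.mk hli hspan.ge
  let e : Fin n ≃ κ := (Pi.basisFun ℂ (Fin n)).indexEquiv b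
  refine ⟨a ∘ e, ?_⟩
  rw [← isUnit_iff_ne_zero, ← Matrix.isUnit_iff_isUnit_det,
    ← Matrix.linearIndependent_cols_iff_isUnit]
  exact hli.comp e e.injective

/-- A matrix projecting onto a given subspace. -/
theorem exists_matrix_projection {K : Type*} [Field K] {n : ℕ} (S : Submodule K (Fin n → K)) :
    ∃ p : Matrix (Fin n) (Fin n) K, (∀ v, p *ᵥ v ∈ S) ∧ ∀ v ∈ S, p *ᵥ v = v := by
  obtain ⟨f, hf⟩ := S.subtype.exists_leftInverse_of_injective S.ker_subtype
  refine ⟨LinearMap.toMatrix' (S.subtype ∘ₗ f), fun v => ?_, fun v hv => ?_⟩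
  · rw [LinearMap.toMatrix'_mulVec]
    exact (f v).2
  · rw [LinearMap.toMatrix'_mulVec]
    exact congrArg Subtype.val (LinearMap.congr_fun hf ⟨v, hv⟩)

theorem mul_eq_self_of_range_le {K : Type*} [Field K] {n m : ℕ} {S : Submodule K (Fin n → K)}
    {p : Matrix (Fin n) (Fin n) K} (hp : ∀ v ∈ S, p *ᵥ v = v) {A : Matrix (Fin n) (Fin m) K}
    (hA : ∀ v, A *ᵥ v ∈ S) : p * A = A := by
  refine Matrix.ext_of_mulVec_single fun a => ?_
  rw [← Matrix.mulVec_mulVec, hp _ (hA _)]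

/-- The curve `t ↦ (p + t⁻¹(1 - p)) • x`, extended over `t = 0` when `p` projects onto a
destabilizing subspace. -/
def degeneration {n m : ℕ} (x : ADHMSpace n m) (p : Matrix (Fin n) (Fin n) ℂ) (t : ℂ) :
    ADHMSpace n m :=
  (fun k l => p * x.1 k l * p + t • (p * x.1 k l * (1 - p)) + (1 - p) * x.1 k l * (1 - p),
   fun l => x.2.1 l,
   fun l => x.2.2 l * (p + t • (1 - p)))

theorem continuous_coords_degeneration {n m : ℕ} (x : ADHMSpace n m)
    (p : Matrix (Fin n) (Fin n) ℂ) : Continuous fun t => ADHMCoords (degeneration x p t) := by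
  refine continuous_pi fun c => ?_
  rcases c with ⟨k, l, a, b⟩ | ⟨l, a, b⟩ | ⟨l, a, b⟩ <;>
    simp only [ADHMCoords, degeneration, Matrix.mul_add, Matrix.mul_smul, Matrix.add_apply,
      Matrix.smul_apply] <;> fun_prop

theorem eval_eq_zero_of_not_stable {n m : ℕ} {x : ADHMSpace n m} (hx : ¬ ADHMStable x) {N : ℕ}
    (hN : 1 ≤ N) {P : MvPolynomial (ADHMCoordIdx n m) ℂ}
    (hP : ∀ (g : (Matrix (Fin n) (Fin n) ℂ)ˣ) (y : ADHMSpace n m),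
      MvPolynomial.eval (ADHMCoords (ADHMAct g y)) P =
        ((g : Matrix (Fin n) (Fin n) ℂ).det) ^ N * MvPolynomial.eval (ADHMCoords y) P) :
    MvPolynomial.eval (ADHMCoords x) P = 0 := by
  simp only [ADHMStable, not_forall, not_not] at hx
  obtain ⟨S, hS, hB, hi⟩ := hx
  obtain ⟨p, hpS, hp⟩ := exists_matrix_projection S
  have hpp : p * p = p := mul_eq_self_of_range_le hp hpS
  have hpB (k l) : p * (x.1 k l * p) = x.1 k l * p := mul_eq_self_of_range_le hp fun v => by
    rw [← Matrix.mulVec_mulVec, ← Matrix.toLin'_apply]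
    exact hB k l (Submodule.mem_map_of_mem (hpS v))
  have hpi (l) : p * x.2.1 l = x.2.1 l := mul_eq_self_of_range_le hp fun v => by
    rw [← Matrix.toLin'_apply]
    fin_cases l
    exacts [hi.1 ⟨v, rfl⟩, hi.2 ⟨v, rfl⟩]
  have hdet : p.det = 0 := by
    by_contra h
    refine hS (eq_top_iff.2 fun v _ => ?_)
    have hu : IsUnit p := (Matrix.isUnit_iff_isUnit_det p).2 (isUnit_iff_ne_zero.2 h)
    have h1 : p = 1 := hu.mul_left_cancel (by rw [hpp, mul_one])
    simpa [h1] using hpS v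
  have hinv {t u : ℂ} (htu : t * u = 1) : (p + t • (1 - p)) * (p + u • (1 - p)) = 1 := by
    have h1 : p * (1 - p) = 0 := by rw [mul_sub, hpp, mul_one, sub_self]
    have h2 : (1 - p) * p = 0 := by rw [sub_mul, hpp, one_mul, sub_self]
    have h3 : (1 - p) * (1 - p) = 1 - p := by rw [mul_sub, h2, mul_one, sub_zero]
    simp [mul_add, add_mul, h1, h2, h3, hpp, smul_smul, htu, mul_comm u t]
  let F : ℂ → ℂ := fun t =>
    (p + t • (1 - p)).det ^ N * MvPolynomial.eval (ADHMCoords (degeneration x p t)) P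
  have hF : Continuous F := by
    have h1 : Continuous fun t : ℂ => (p + t • (1 - p)).det := by fun_prop
    exact (h1.pow N).mul
      ((MvPolynomial.continuous_eval P).comp (continuous_coords_degeneration x p))
  have hFt : ∀ t ∈ ({0}ᶜ : Set ℂ), F t = MvPolynomial.eval (ADHMCoords x) P := by
    intro t ht
    have ht0 : t ≠ 0 := ht
    let g : (Matrix (Fin n) (Fin n) ℂ)ˣ :=
      ⟨p + t⁻¹ • (1 - p), p + t • (1 - p), hinv (inv_mul_cancel₀ ht0), hinv (mul_inv_cancel₀ ht0)⟩
    have hg : ADHMAct g x = degeneration x p t := by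
      refine Prod.ext ?_ (Prod.ext ?_ rfl)
      · funext k l
        change (p + t⁻¹ • (1 - p)) * x.1 k l * (p + t • (1 - p)) = _
        have h0 : (1 - p) * (x.1 k l * p) = 0 := by rw [sub_mul, hpB, one_mul, sub_self]
        simp only [degeneration, add_mul, mul_add, Matrix.smul_mul, Matrix.mul_smul,
          Matrix.mul_assoc, h0, smul_zero, zero_add, smul_smul, mul_inv_cancel₀ ht0,
          one_smul, add_assoc]
      · funext l
        change (p + t⁻¹ • (1 - p)) * x.2.1 l = x.2.1 l
        rw [Matrix.add_mul, Matrix.smul_mul, Matrix.sub_mul, hpi, Matrix.one_mul, sub_self,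
          smul_zero, add_zero]
    have hd : (p + t • (1 - p)).det * (g : Matrix (Fin n) (Fin n) ℂ).det = 1 := by
      rw [← Matrix.det_mul, ← Matrix.det_one (n := Fin n) (R := ℂ)]
      exact congrArg Matrix.det g.inv_mul
    change _ ^ N * _ = _
    rw [← hg, hP, ← mul_assoc, ← mul_pow, hd, one_pow, one_mul]
  have hconst := hF.ext_on (dense_compl_singleton (0 : ℂ)) continuous_const hFt
  have h0 := congrFun hconst 0
  simpa [F, hdet, Nat.one_le_iff_ne_zero.1 hN] using h0.symm

/-- an ADHM datum `x` for `ℙ¹` over `ℂ` is stable if and only if there exist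
`N ≥ 1` and a polynomial function `f` on `B̃` with `f(g·y) = det(g)^N · f(y)` for all
`g ∈ GL(V)`, `y ∈ B̃`, and `f(x) ≠ 0` (GIT semistability with respect to `det`). -/
theorem ADHMStable_iff_GIT_semistable {n m : ℕ} (x : ADHMSpace n m) (hx : ADHMEq x) :
    ADHMStable x ↔
      ∃ (N : ℕ) (P : MvPolynomial (ADHMCoordIdx n m) ℂ), 1 ≤ N ∧
        (∀ (g : (Matrix (Fin n) (Fin n) ℂ)ˣ) (y : ADHMSpace n m),
          MvPolynomial.eval (ADHMCoords (ADHMAct g y)) P =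
            ((g : Matrix (Fin n) (Fin n) ℂ).det) ^ N *
              MvPolynomial.eval (ADHMCoords y) P) ∧
        MvPolynomial.eval (ADHMCoords x) P ≠ 0 := by
  constructor
  · intro h
    obtain ⟨s, hs⟩ := exists_wordMatrix_det_ne_zero h
    refine ⟨1, wordPoly s, le_rfl, fun g y => ?_, by rwa [eval_wordPoly]⟩
    rw [eval_wordPoly, eval_wordPoly, wordMatrix_ADHMAct, Matrix.det_mul, pow_one]
  · rintro ⟨N, P, hN, hP, hne⟩
    by_contra h
    exact hne (eval_eq_zero_of_not_stable h hN hP)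
end

section
/- Let x be an ADHM datum for ℙ¹ over k = ℂ. Then the following are equivalent: (1) the orbit GL(V)·x is a closed subset of B̃ (in its standard topology as a finite-dimensional complex vector space) and the stabilizer of x in GL(V) is trivial; (2) x is stable and costable (i.e. regular). -/
open Matrix

/-- Costability of an ADHM datum for `ℙ¹`: no nonzero subspace `S ⊆ V` invariant under
all four `B`-components is contained in `ker j₀ ∩ ker j₁`. -/
def ADHMCostable {n m : ℕ} (x : ADHMSpace n m) : Prop :=
  ∀ S : Submodule ℂ (Fin n → ℂ), S ≠ ⊥ →
    (∀ k l : Fin 2, S.map (Matrix.toLin' (x.1 k l)) ≤ S) →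
    ¬(S ≤ LinearMap.ker (Matrix.toLin' (x.2.2 0)) ⊓
          LinearMap.ker (Matrix.toLin' (x.2.2 1)))

namespace ADHM

variable {n m : ℕ}

theorem act_mul (g h : (Matrix (Fin n) (Fin n) ℂ)ˣ) (x : ADHMSpace n m) :
    ADHMAct (g * h) x = ADHMAct g (ADHMAct h x) := by
  simp [ADHMAct, Matrix.mul_assoc]

theorem act_one (x : ADHMSpace n m) : ADHMAct 1 x = x := by
  simp [ADHMAct]

theorem act_inv_act (g : (Matrix (Fin n) (Fin n) ℂ)ˣ) (x : ADHMSpace n m) :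
    ADHMAct g⁻¹ (ADHMAct g x) = x := by
  rw [← act_mul, inv_mul_cancel, act_one]

theorem continuous_act (g : (Matrix (Fin n) (Fin n) ℂ)ˣ) :
    Continuous (ADHMAct (m := m) g) := by
  unfold ADHMAct
  fun_prop

/-! ### Regular data have closed orbits -/

/-- The representation of the free algebra given by the four endomorphisms of a datum. -/
noncomputable def rep (x : ADHMSpace n m) :
    FreeAlgebra ℂ (Fin 2 × Fin 2) →ₐ[ℂ] Matrix (Fin n) (Fin n) ℂ :=
  FreeAlgebra.lift ℂ fun p => x.1 p.1 p.2

theorem rep_ι (x : ADHMSpace n m) (p : Fin 2 × Fin 2) :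
    rep x (FreeAlgebra.ι ℂ p) = x.1 p.1 p.2 := by
  simp [rep]

theorem continuous_rep (a : FreeAlgebra ℂ (Fin 2 × Fin 2)) :
    Continuous fun x : ADHMSpace n m => rep x a := by
  induction a using FreeAlgebra.induction with
  | grade0 r => simpa using continuous_const
  | grade1 p => simp only [rep_ι]; fun_prop
  | mul a b ha hb => simpa using ha.matrix_mul hb
  | add a b ha hb => simp only [map_add]; exact ha.add hb

theorem rep_act (g : (Matrix (Fin n) (Fin n) ℂ)ˣ) (x : ADHMSpace n m)
    (a : FreeAlgebra ℂ (Fin 2 × Fin 2)) :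
    rep (ADHMAct g x) a = g.val * rep x a * (g⁻¹).val := by
  induction a using FreeAlgebra.induction with
  | grade0 r => simp [Algebra.algebraMap_eq_smul_one]
  | grade1 p => simp only [rep_ι, ADHMAct]
  | mul a b ha hb => simp only [map_mul, ha, hb, mul_assoc, Units.inv_mul_cancel_left]
  | add a b ha hb => simp only [map_add, ha, hb, mul_add, add_mul]

/-- The controllability map of a datum. -/
noncomputable def control (x : ADHMSpace n m) :
    (Fin 2 → Fin m → FreeAlgebra ℂ (Fin 2 × Fin 2)) →ₗ[ℂ] (Fin n → ℂ) where
  toFun a := ∑ l, ∑ q, rep x (a l q) *ᵥ (x.2.1 l).col q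
  map_add' a b := by simp [Matrix.add_mulVec, Finset.sum_add_distrib]
  map_smul' c a := by simp [Matrix.smul_mulVec, Finset.smul_sum]

theorem control_apply (x : ADHMSpace n m) (a) :
    control x a = ∑ l, ∑ q, rep x (a l q) *ᵥ (x.2.1 l).col q := rfl

/-- The observability map of a datum. -/
noncomputable def observe (x : ADHMSpace n m) :
    (Fin n → ℂ) →ₗ[ℂ] (Fin 2 → FreeAlgebra ℂ (Fin 2 × Fin 2) → Fin m → ℂ) where
  toFun v l a := x.2.2 l *ᵥ (rep x a *ᵥ v)
  map_add' v w := by ext; simp [Matrix.mulVec_add]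
  map_smul' c v := by ext; simp [Matrix.mulVec_smul]

theorem observe_apply (x : ADHMSpace n m) (v l a) :
    observe x v l a = x.2.2 l *ᵥ (rep x a *ᵥ v) := rfl

theorem control_ι_mul (x : ADHMSpace n m) (p : Fin 2 × Fin 2) (a) :
    control x (fun l q => FreeAlgebra.ι ℂ p * a l q) = x.1 p.1 p.2 *ᵥ control x a := by
  simp only [control_apply, map_mul, rep_ι, Matrix.mulVec_sum, Matrix.mulVec_mulVec]

theorem control_const (x : ADHMSpace n m) (l : Fin 2) (w : Fin m → ℂ) :
    control x (Pi.single l fun q => algebraMap ℂ _ (w q)) = x.2.1 l *ᵥ w := by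
  rw [control_apply, Finset.sum_eq_single l]
  · ext k
    simp [Algebra.algebraMap_eq_smul_one, Matrix.smul_mulVec, Matrix.mulVec, dotProduct, mul_comm]
  · intro b _ hb
    simp [Pi.single_eq_of_ne hb]
  · simp

theorem observe_mulVec (x : ADHMSpace n m) (p : Fin 2 × Fin 2) (v l a) :
    observe x (x.1 p.1 p.2 *ᵥ v) l a = observe x v l (a * FreeAlgebra.ι ℂ p) := by
  simp [observe_apply, rep_ι, Matrix.mulVec_mulVec]

theorem observe_one (x : ADHMSpace n m) (v l) : observe x v l 1 = x.2.2 l *ᵥ v := by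
  simp [observe_apply]

theorem control_surjective {x : ADHMSpace n m} (hx : ADHMStable x) :
    Function.Surjective (control x) := by
  rw [← LinearMap.range_eq_top]
  by_contra h
  refine hx _ h ?_ ?_
  · rintro k l _ ⟨_, ⟨a, rfl⟩, rfl⟩
    exact ⟨_, control_ι_mul x (k, l) a⟩
  · constructor <;> rintro _ ⟨w, rfl⟩ <;> exact ⟨_, control_const x _ w⟩

theorem observe_injective {x : ADHMSpace n m} (hx : ADHMCostable x) :
    Function.Injective (observe x) := by
  rw [← LinearMap.ker_eq_bot]
  by_contra h
  refine hx _ h ?_ ?_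
  · rintro k l _ ⟨v, hv, rfl⟩
    have hv' : observe x v = 0 := hv
    change observe x (x.1 k l *ᵥ v) = 0
    ext l' a
    rw [observe_mulVec x (k, l), hv']
    rfl
  · intro v hv
    have hv' : observe x v = 0 := hv
    constructor <;>
    · change _ *ᵥ v = 0
      rw [← observe_one, hv']
      rfl

theorem continuous_observe_control (a l b) :
    Continuous fun x : ADHMSpace n m => observe x (control x a) l b := by
  simp only [observe_apply, control_apply]
  have h1 : Continuous fun x : ADHMSpace n m =>
      ∑ l, ∑ q, rep x (a l q) *ᵥ (x.2.1 l).col q := by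
    refine continuous_finsetSum _ fun l _ => continuous_finsetSum _ fun q _ => ?_
    refine (continuous_rep _).matrix_mulVec ?_
    unfold Matrix.col Matrix.transpose
    fun_prop
  exact Continuous.matrix_mulVec (by fun_prop) ((continuous_rep b).matrix_mulVec h1)

theorem control_act (g : (Matrix (Fin n) (Fin n) ℂ)ˣ) (x : ADHMSpace n m) (a) :
    control (ADHMAct g x) a = g.val *ᵥ control x a := by
  have h (l q) : ((ADHMAct g x).2.1 l).col q = g.val *ᵥ (x.2.1 l).col q := rfl
  simp only [control_apply, rep_act, h, Matrix.mulVec_sum, Matrix.mulVec_mulVec, mul_assoc,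
    Units.inv_mul, mul_one]

theorem observe_act (g : (Matrix (Fin n) (Fin n) ℂ)ˣ) (x : ADHMSpace n m) (v l a) :
    observe (ADHMAct g x) (g.val *ᵥ v) l a = observe x v l a := by
  have h : (ADHMAct g x).2.2 l = x.2.2 l * (g⁻¹).val := rfl
  simp only [observe_apply, rep_act, h, Matrix.mulVec_mulVec, Matrix.mul_assoc,
    Units.inv_mul, mul_one]
  rw [← Matrix.mul_assoc (g⁻¹).val, Units.inv_mul, Matrix.one_mul]

theorem observe_control_eq_of_mem_closure {x y : ADHMSpace n m}
    (hy : y ∈ closure {y : ADHMSpace n m | ∃ g, y = ADHMAct g x}) (a) :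
    observe y (control y a) = observe x (control x a) := by
  ext l b : 2
  have hc : IsClosed {y : ADHMSpace n m | observe y (control y a) l b =
      observe x (control x a) l b} :=
    isClosed_eq (continuous_observe_control a l b) continuous_const
  refine closure_minimal ?_ hc hy
  rintro _ ⟨g, rfl⟩
  simp only [Set.mem_ofPred_eq, control_act, observe_act]

/-- The realization of a Hankel map by a regular datum is unique up to the action. -/
theorem exists_eq_act_of_observe_control_eq {x y : ADHMSpace n m}
    (hs : ADHMStable x) (hc : ADHMCostable x)
    (h : ∀ a, observe y (control y a) = observe x (control x a)) :
    ∃ g, y = ADHMAct g x := by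
  have hCx := control_surjective hs
  have hOx := observe_injective hc
  obtain ⟨σ, hσ⟩ := (control x).exists_rightInverse_of_surjective (LinearMap.range_eq_top.2 hCx)
  have hσ' (v) : control x (σ v) = v := LinearMap.congr_fun hσ v
  let f : (Fin n → ℂ) →ₗ[ℂ] (Fin n → ℂ) := control y ∘ₗ σ
  have hOf (v) : observe y (f v) = observe x v := by
    change observe y (control y (σ v)) = _
    rw [h, hσ']
  have hf : Function.Injective f := fun v w hvw => hOx (by rw [← hOf, ← hOf, hvw])
  have hf' : Function.Surjective f := LinearMap.injective_iff_surjective.1 hf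
  have hOy : Function.Injective (observe y) := by
    intro v w hvw
    obtain ⟨v, rfl⟩ := hf' v
    obtain ⟨w, rfl⟩ := hf' w
    rw [hOf, hOf] at hvw
    rw [hOx hvw]
  have hfC (a) : f (control x a) = control y a := hOy (by rw [hOf, h])
  let M := LinearMap.toMatrix' f
  have hM (v) : M *ᵥ v = f v := LinearMap.toMatrix'_mulVec f v
  have hMu : IsUnit M := by
    rw [← Matrix.mulVec_injective_iff_isUnit]
    intro v w hvw
    exact hf (by simpa only [hM] using hvw)
  obtain ⟨g, hg⟩ := hMu
  have hB (k l) : y.1 k l * M = M * x.1 k l := by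
    refine Matrix.ext_iff_mulVec.2 fun v => ?_
    obtain ⟨a, rfl⟩ := hCx v
    rw [← Matrix.mulVec_mulVec, ← Matrix.mulVec_mulVec, hM, hM, hfC, ← control_ι_mul y (k, l),
      ← control_ι_mul x (k, l), hfC]
  have hi (l) : M * x.2.1 l = y.2.1 l := by
    refine Matrix.ext_iff_mulVec.2 fun v => ?_
    rw [← Matrix.mulVec_mulVec, hM, ← control_const, hfC, control_const]
  have hj (l) : y.2.2 l * M = x.2.2 l := by
    refine Matrix.ext_iff_mulVec.2 fun v => ?_
    rw [← Matrix.mulVec_mulVec, hM, ← observe_one, hOf, observe_one]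
  refine ⟨g, Prod.ext ?_ (Prod.ext ?_ ?_)⟩
  · ext k l : 2
    change y.1 k l = g.val * x.1 k l * (g⁻¹).val
    rw [hg, ← hB, ← hg, mul_assoc, Units.mul_inv, mul_one]
  · ext l : 1
    change y.2.1 l = g.val * x.2.1 l
    rw [hg, hi]
  · ext l : 1
    change y.2.2 l = x.2.2 l * (g⁻¹).val
    rw [← hj, ← hg, Matrix.mul_assoc, Units.mul_inv, Matrix.mul_one]

theorem isClosed_orbit {x : ADHMSpace n m} (hs : ADHMStable x) (hc : ADHMCostable x) :
    IsClosed {y : ADHMSpace n m | ∃ g : (Matrix (Fin n) (Fin n) ℂ)ˣ, y = ADHMAct g x} :=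
  isClosed_of_closure_subset fun _ hy =>
    exists_eq_act_of_observe_control_eq hs hc (observe_control_eq_of_mem_closure hy)

theorem eq_one_of_act_eq {x : ADHMSpace n m} (hs : ADHMStable x)
    {g : (Matrix (Fin n) (Fin n) ℂ)ˣ} (hg : ADHMAct g x = x) : g = 1 := by
  refine Units.ext (Matrix.ext_iff_mulVec.2 fun v => ?_)
  obtain ⟨a, rfl⟩ := control_surjective hs v
  rw [← control_act, hg, Units.val_one, Matrix.one_mulVec]

/-! ### Degenerations of non-regular data -/

/-- If the orbit of `x` is closed with trivial stabilizer, then any one-parameter subgroup along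
which `x` has a limit at `0` is trivial. -/
theorem eq_one_of_isClosed_orbit {x : ADHMSpace n m}
    (hcl : IsClosed {y : ADHMSpace n m | ∃ g : (Matrix (Fin n) (Fin n) ℂ)ˣ, y = ADHMAct g x})
    (hst : ∀ g : (Matrix (Fin n) (Fin n) ℂ)ˣ, ADHMAct g x = x → g = 1)
    (u : ℂˣ →* (Matrix (Fin n) (Fin n) ℂ)ˣ) {f : ℂ → ADHMSpace n m} (hf : Continuous f)
    (hfu : ∀ t : ℂˣ, f t = ADHMAct (u t) x) (s : ℂˣ) : u s = 1 := by
  have hd : Dense ({0}ᶜ : Set ℂ) := dense_compl_singleton 0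
  obtain ⟨g, hg⟩ : f 0 ∈ {y : ADHMSpace n m | ∃ g, y = ADHMAct g x} := by
    refine (hcl.preimage hf).closure_subset_iff.2 ?_ (hd 0)
    intro t ht
    exact ⟨u (Units.mk0 t ht), hfu (Units.mk0 t ht)⟩
  have hs : ADHMAct (u s) (f 0) = f 0 := by
    have := Continuous.ext_on hd ((continuous_act (u s)).comp hf)
      (hf.comp (continuous_const_mul (s : ℂ))) (fun t ht => by
        have h1 := hfu (Units.mk0 t ht)
        have h2 := hfu (s * Units.mk0 t ht)
        rw [map_mul, act_mul, ← h1] at h2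
        exact h2.symm)
    simpa using congrFun this 0
  have h1 := hst (g⁻¹ * u s * g) (by rw [act_mul, act_mul, ← hg, hs, hg, act_inv_act])
  rwa [mul_assoc, inv_mul_eq_one, eq_comm, mul_eq_right] at h1

/-- The one-parameter subgroup acting by `1` on the range of an idempotent and with weight one
on its kernel. -/
noncomputable def idempotentScaling {E : Matrix (Fin n) (Fin n) ℂ} (hE : E * E = E) :
    ℂˣ →* (Matrix (Fin n) (Fin n) ℂ)ˣ :=
  MonoidHom.toHomUnits
    { toFun := fun t => E + (t : ℂ) • (1 - E)
      map_one' := by simp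
      map_mul' := fun s t => by
        simp [mul_add, add_mul, mul_sub, sub_mul, hE, smul_smul, mul_comm] }

theorem coe_idempotentScaling {E : Matrix (Fin n) (Fin n) ℂ} (hE : E * E = E) (t : ℂˣ) :
    (idempotentScaling hE t : Matrix (Fin n) (Fin n) ℂ) = E + (t : ℂ) • (1 - E) := rfl

theorem eq_one_of_idempotentScaling_eq_one {E : Matrix (Fin n) (Fin n) ℂ} (hE : E * E = E)
    (h : idempotentScaling hE (Units.mk0 2 two_ne_zero) = 1) : E = 1 := by
  have h2 := congrArg Units.val h
  rw [coe_idempotentScaling, Units.val_mk0, Units.val_one, two_smul] at h2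
  have h3 : E + (1 - E + (1 - E)) = 1 + (1 - E) := by abel
  rw [h3, add_eq_left, sub_eq_zero] at h2
  exact h2.symm

theorem exists_projection (S : Submodule ℂ (Fin n → ℂ)) :
    ∃ P : Matrix (Fin n) (Fin n) ℂ, (∀ v, P *ᵥ v ∈ S) ∧ ∀ v ∈ S, P *ᵥ v = v := by
  obtain ⟨p, hp⟩ := S.subtype.exists_leftInverse_of_injective S.ker_subtype
  refine ⟨LinearMap.toMatrix' (S.subtype ∘ₗ p), fun v => ?_, fun v hv => ?_⟩
  · rw [LinearMap.toMatrix'_mulVec]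
    exact (p v).2
  · rw [LinearMap.toMatrix'_mulVec]
    exact congrArg Subtype.val (LinearMap.congr_fun hp ⟨v, hv⟩)

theorem stable_of_isClosed_orbit {x : ADHMSpace n m}
    (hcl : IsClosed {y : ADHMSpace n m | ∃ g : (Matrix (Fin n) (Fin n) ℂ)ˣ, y = ADHMAct g x})
    (hst : ∀ g : (Matrix (Fin n) (Fin n) ℂ)ˣ, ADHMAct g x = x → g = 1) : ADHMStable x := by
  intro S hS hB hi
  obtain ⟨P, hPS, hP⟩ := exists_projection S
  have hPP : P * P = P := Matrix.ext_iff_mulVec.2 fun v => by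
    rw [← Matrix.mulVec_mulVec, hP _ (hPS v)]
  have hPB (k l) : P * (x.1 k l * P) = x.1 k l * P := Matrix.ext_iff_mulVec.2 fun v => by
    rw [← Matrix.mulVec_mulVec, ← Matrix.mulVec_mulVec]
    exact hP _ (hB k l ⟨_, hPS v, rfl⟩)
  have hPi (l) : P * x.2.1 l = x.2.1 l := Matrix.ext_iff_mulVec.2 fun v => by
    rw [← Matrix.mulVec_mulVec]
    refine hP _ ?_
    fin_cases l
    · exact hi.1 ⟨v, rfl⟩
    · exact hi.2 ⟨v, rfl⟩
  let f : ℂ → ADHMSpace n m := fun t =>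
    (fun k l => x.1 k l * P + (1 - P) * x.1 k l * (1 - P) + t • (P * x.1 k l * (1 - P)),
      x.2.1, fun l => x.2.2 l * (P + t • (1 - P)))
  have hf : Continuous f := by fun_prop
  refine hS ?_
  have h1 := eq_one_of_isClosed_orbit hcl hst
    ((idempotentScaling hPP).comp (invMonoidHom : ℂˣ →* ℂˣ)) hf (fun t => ?_)
    (Units.mk0 2 two_ne_zero)⁻¹
  · have hP1 : P = 1 := eq_one_of_idempotentScaling_eq_one hPP (by simpa using h1)
    refine eq_top_iff.2 fun v _ => ?_
    simpa [hP1] using hPS v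
  · have ht : (t : ℂ) ≠ 0 := t.ne_zero
    refine Prod.ext ?_ (Prod.ext ?_ ?_)
    · ext k l : 2
      simp only [f, ADHMAct, MonoidHom.comp_apply, invMonoidHom_apply, ← map_inv, inv_inv,
        coe_idempotentScaling]
      simp only [Units.val_inv_eq_inv_val, mul_add, add_mul, mul_sub, sub_mul,
        smul_mul_assoc, mul_smul_comm, smul_sub, mul_one, one_mul, mul_assoc, hPB, smul_add, smul_smul,
        mul_inv_cancel₀ ht, one_smul]
      abel
    · ext l : 1
      simp only [f, ADHMAct, MonoidHom.comp_apply, invMonoidHom_apply,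
        coe_idempotentScaling]
      simp [Matrix.add_mul, Matrix.sub_mul, hPi]
    · ext l : 1
      simp only [f, ADHMAct, MonoidHom.comp_apply, invMonoidHom_apply, ← map_inv, inv_inv,
        coe_idempotentScaling]

theorem costable_of_isClosed_orbit {x : ADHMSpace n m}
    (hcl : IsClosed {y : ADHMSpace n m | ∃ g : (Matrix (Fin n) (Fin n) ℂ)ˣ, y = ADHMAct g x})
    (hst : ∀ g : (Matrix (Fin n) (Fin n) ℂ)ˣ, ADHMAct g x = x → g = 1) : ADHMCostable x := by
  intro S hS hB hj
  obtain ⟨P, hPS, hP⟩ := exists_projection S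
  have hPP : P * P = P := Matrix.ext_iff_mulVec.2 fun v => by
    rw [← Matrix.mulVec_mulVec, hP _ (hPS v)]
  have hQQ : (1 - P) * (1 - P) = 1 - P := by simp [mul_sub, sub_mul, hPP]
  have hPB (k l) : P * (x.1 k l * P) = x.1 k l * P := Matrix.ext_iff_mulVec.2 fun v => by
    rw [← Matrix.mulVec_mulVec, ← Matrix.mulVec_mulVec]
    exact hP _ (hB k l ⟨_, hPS v, rfl⟩)
  have hjP (l) : x.2.2 l * P = 0 := Matrix.ext_iff_mulVec.2 fun v => by
    rw [← Matrix.mulVec_mulVec, Matrix.zero_mulVec]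
    fin_cases l
    · exact (hj (hPS v)).1
    · exact (hj (hPS v)).2
  let f : ℂ → ADHMSpace n m := fun t =>
    (fun k l => x.1 k l * P + (1 - P) * x.1 k l * (1 - P) + t • (P * x.1 k l * (1 - P)),
      fun l => ((1 - P) + t • P) * x.2.1 l, x.2.2)
  have hf : Continuous f := by fun_prop
  refine hS ?_
  have h1 := eq_one_of_isClosed_orbit hcl hst (idempotentScaling hQQ) hf (fun t => ?_)
    (Units.mk0 2 two_ne_zero)
  · have hP0 : P = 0 := by
      simpa using eq_one_of_idempotentScaling_eq_one hQQ h1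
    refine eq_bot_iff.2 fun v hv => ?_
    rw [← hP v hv, hP0, Matrix.zero_mulVec]
    exact Submodule.zero_mem _
  · have ht : (t : ℂ) ≠ 0 := t.ne_zero
    refine Prod.ext ?_ (Prod.ext ?_ ?_)
    · ext k l : 2
      simp only [f, ADHMAct, ← map_inv, coe_idempotentScaling, sub_sub_cancel]
      simp only [Units.val_inv_eq_inv_val, mul_add, add_mul, mul_sub, sub_mul,
        smul_mul_assoc, mul_smul_comm, smul_sub, mul_one, one_mul, mul_assoc, hPB, smul_add, smul_smul,
        inv_mul_cancel₀ ht, one_smul]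
      abel
    · ext l : 1
      simp only [f, ADHMAct, coe_idempotentScaling, sub_sub_cancel]
    · ext l : 1
      simp only [f, ADHMAct, ← map_inv, coe_idempotentScaling, sub_sub_cancel]
      simp [Matrix.mul_add, Matrix.mul_sub, hjP]

end ADHM

/-- for an ADHM datum `x` for `ℙ¹` over `ℂ`, the orbit `GL(V)·x` is closed
in `B̃` and the stabilizer of `x` is trivial if and only if `x` is stable and costable
(i.e. regular). -/
theorem closed_orbit_trivial_stabilizer_iff_regular {n m : ℕ}
    (x : ADHMSpace n m) (hx : ADHMEq x) :
    (IsClosed {y : ADHMSpace n m | ∃ g : (Matrix (Fin n) (Fin n) ℂ)ˣ, y = ADHMAct g x} ∧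
      ∀ g : (Matrix (Fin n) (Fin n) ℂ)ˣ, ADHMAct g x = x → g = 1) ↔
    (ADHMStable x ∧ ADHMCostable x) := by
  exact ⟨fun h => ⟨ADHM.stable_of_isClosed_orbit h.1 h.2, ADHM.costable_of_isClosed_orbit h.1 h.2⟩,
    fun h => ⟨ADHM.isClosed_orbit h.1 h.2, fun _ => ADHM.eq_one_of_act_eq h.1⟩⟩
end

section
/- Let x be an ADHM datum for ℙ¹ over a field k, and suppose V = V₁ ⊕ V₂ is a direct sum decomposition such that B_{k,l}(V₁) ⊆ V₁ and B_{k,l}(V₂) ⊆ V₂ for all k ∈ {1,2}, l ∈ {0,1}, im i₀ ⊆ V₁, im i₁ ⊆ V₁, V₂ ⊆ ker j₀ ∩ ker j₁, and the induced ADHM datum x₁ = (B_{k,l}|_{V₁}, i_l, j_l|_{V₁}) on (W, V₁) is stable and costable. Then V₁ is the smallest subspace S ⊆ V satisfying B_{k,l}(S) ⊆ S for all k,l and im i₀ ⊆ S, im i₁ ⊆ S; and V₂ is the biggest subspace S ⊆ V satisfying B_{k,l}(S) ⊆ S for all k,l and S ⊆ ker j₀ ∩ ker j₁. In particular such a decomposition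 is unique. -/
/-- A decomposition `V = V₁ ⊕ V₂` of an ADHM datum for `ℙ¹` as in
Remark `CharacterisationOfDecomposition`: both summands invariant under all
`B`-components, images of the `i`-components in `V₁`, `V₂ ⊆ ker j₀ ∩ ker j₁`,
and the induced datum `x₁` on `(W, V₁)` stable and costable. -/
def IsADHMDecomp {k V W : Type*} [Field k] [AddCommGroup V] [Module k V]
    [AddCommGroup W] [Module k W]
    (B10 B11 B20 B21 : V →ₗ[k] V) (i0 i1 : W →ₗ[k] V) (j0 j1 : V →ₗ[k] W)
    (V₁ V₂ : Submodule k V) : Prop :=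
  IsCompl V₁ V₂ ∧
  (V₁.map B10 ≤ V₁ ∧ V₁.map B11 ≤ V₁ ∧ V₁.map B20 ≤ V₁ ∧ V₁.map B21 ≤ V₁) ∧
  (V₂.map B10 ≤ V₂ ∧ V₂.map B11 ≤ V₂ ∧ V₂.map B20 ≤ V₂ ∧ V₂.map B21 ≤ V₂) ∧
  (LinearMap.range i0 ≤ V₁ ∧ LinearMap.range i1 ≤ V₁) ∧
  V₂ ≤ LinearMap.ker j0 ⊓ LinearMap.ker j1 ∧
  -- the induced datum `x₁` on `(W, V₁)` is stable
  (∀ S : Submodule k V, S < V₁ →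
    S.map B10 ≤ S → S.map B11 ≤ S → S.map B20 ≤ S → S.map B21 ≤ S →
    ¬(LinearMap.range i0 ≤ S ∧ LinearMap.range i1 ≤ S)) ∧
  -- the induced datum `x₁` on `(W, V₁)` is costable
  (∀ S : Submodule k V, S ≤ V₁ → S ≠ ⊥ →
    S.map B10 ≤ S → S.map B11 ≤ S → S.map B20 ≤ S → S.map B21 ≤ S →
    ¬(S ≤ LinearMap.ker j0 ⊓ LinearMap.ker j1))

theorem map_inf_le_of_map_le {R M : Type*} [Semiring R] [AddCommMonoid M] [Module R M]
    {f : M →ₗ[R] M} {S T : Submodule R M} (hS : S.map f ≤ S) (hT : T.map f ≤ T) :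
    (S ⊓ T).map f ≤ S ⊓ T :=
  le_inf ((Submodule.map_mono inf_le_left).trans hS) ((Submodule.map_mono inf_le_right).trans hT)

theorem map_sup_le_of_map_le {R M : Type*} [Semiring R] [AddCommMonoid M] [Module R M]
    {f : M →ₗ[R] M} {S T : Submodule R M} (hS : S.map f ≤ S) (hT : T.map f ≤ T) :
    (S ⊔ T).map f ≤ S ⊔ T :=
  (Submodule.map_sup S T f).le.trans (sup_le_sup hS hT)

/-- in any such decomposition, `V₁` is the smallest `B`-invariant subspace
containing the images of `i₀` and `i₁`, and `V₂` is the biggest `B`-invariant subspace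
contained in `ker j₀ ∩ ker j₁`; in particular the decomposition is unique. -/
theorem ADHMDecomp_minimal_maximal_unique
    {k V W : Type*} [Field k]
    [AddCommGroup V] [Module k V] [FiniteDimensional k V]
    [AddCommGroup W] [Module k W] [FiniteDimensional k W]
    (B10 B11 B20 B21 : V →ₗ[k] V) (i0 i1 : W →ₗ[k] V) (j0 j1 : V →ₗ[k] W)
    -- the ADHM equations
    (heq1 : B10 ∘ₗ B20 - B20 ∘ₗ B10 + i0 ∘ₗ j0 = 0)
    (heq2 : B10 ∘ₗ B21 - B21 ∘ₗ B10 + B11 ∘ₗ B20 - B20 ∘ₗ B11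
              + i0 ∘ₗ j1 + i1 ∘ₗ j0 = 0)
    (heq3 : B11 ∘ₗ B21 - B21 ∘ₗ B11 + i1 ∘ₗ j1 = 0)
    (V₁ V₂ : Submodule k V)
    (h : IsADHMDecomp B10 B11 B20 B21 i0 i1 j0 j1 V₁ V₂) :
    -- `V₁` is the smallest invariant subspace containing the images of `i₀`, `i₁`
    (∀ S : Submodule k V,
      S.map B10 ≤ S → S.map B11 ≤ S → S.map B20 ≤ S → S.map B21 ≤ S →
      LinearMap.range i0 ≤ S → LinearMap.range i1 ≤ S → V₁ ≤ S) ∧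
    -- `V₂` is the biggest invariant subspace contained in `ker j₀ ∩ ker j₁`
    (∀ S : Submodule k V,
      S.map B10 ≤ S → S.map B11 ≤ S → S.map B20 ≤ S → S.map B21 ≤ S →
      S ≤ LinearMap.ker j0 ⊓ LinearMap.ker j1 → S ≤ V₂) ∧
    -- in particular the decomposition is unique
    (∀ V₁' V₂' : Submodule k V,
      IsADHMDecomp B10 B11 B20 B21 i0 i1 j0 j1 V₁' V₂' → V₁' = V₁ ∧ V₂' = V₂) := by
  obtain ⟨hc, ⟨a1, a2, a3, a4⟩, ⟨b1, b2, b3, b4⟩, ⟨hi0, hi1⟩, hj, hst, hco⟩ := h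
  have hmin : ∀ S : Submodule k V,
      S.map B10 ≤ S → S.map B11 ≤ S → S.map B20 ≤ S → S.map B21 ≤ S →
      LinearMap.range i0 ≤ S → LinearMap.range i1 ≤ S → V₁ ≤ S := by
    intro S s1 s2 s3 s4 r0 r1
    by_contra hS
    exact hst (S ⊓ V₁) (inf_lt_right.mpr hS) (map_inf_le_of_map_le s1 a1)
      (map_inf_le_of_map_le s2 a2) (map_inf_le_of_map_le s3 a3) (map_inf_le_of_map_le s4 a4)
      ⟨le_inf r0 hi0, le_inf r1 hi1⟩
  have hmax : ∀ S : Submodule k V,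
      S.map B10 ≤ S → S.map B11 ≤ S → S.map B20 ≤ S → S.map B21 ≤ S →
      S ≤ LinearMap.ker j0 ⊓ LinearMap.ker j1 → S ≤ V₂ := by
    intro S s1 s2 s3 s4 hS
    have hbot : (S ⊔ V₂) ⊓ V₁ = ⊥ := by
      by_contra hne
      exact hco _ inf_le_right hne
        (map_inf_le_of_map_le (map_sup_le_of_map_le s1 b1) a1)
        (map_inf_le_of_map_le (map_sup_le_of_map_le s2 b2) a2)
        (map_inf_le_of_map_le (map_sup_le_of_map_le s3 b3) a3)
        (map_inf_le_of_map_le (map_sup_le_of_map_le s4 b4) a4)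
        (inf_le_left.trans (sup_le hS hj))
    have heq : V₂ = S ⊔ V₂ := eq_of_le_of_inf_le_of_sup_le (z := V₁) le_sup_right
      (hbot.le.trans bot_le) (le_top.trans hc.symm.sup_eq_top.ge)
    exact le_sup_left.trans heq.ge
  refine ⟨hmin, hmax, ?_⟩
  rintro V₁' V₂' ⟨hc', ⟨a1', a2', a3', a4'⟩, ⟨b1', b2', b3', b4'⟩, ⟨hi0', hi1'⟩, hj', hst', -⟩
  have h₁ : V₁' = V₁ := by
    refine (eq_of_le_of_not_lt (hmin V₁' a1' a2' a3' a4' hi0' hi1') fun hlt => ?_).symm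
    exact hst' V₁ hlt a1 a2 a3 a4 ⟨hi0, hi1⟩
  subst h₁
  exact ⟨rfl, eq_of_le_of_inf_le_of_sup_le (z := V₁') (hmax V₂' b1' b2' b3' b4' hj')
    (hc.symm.inf_eq_bot.le.trans bot_le) (le_top.trans hc'.symm.sup_eq_top.ge)⟩
end

section
/- Let k be a field of characteristic ≠ 2, V = k², W = k. Define the ADHM datum x for ℙ¹ by B₁₀ = [[1,1],[0,0]], B₁₁ = [[0,0],[1,1]], B₂₀ = [[1,-1],[0,0]], B₂₁ = [[0,0],[1,-1]], i₀ = (1,0)ᵀ, i₁ = (0,1)ᵀ, j₀ = (0,2), j₁ = (-2,0) (so that, with B̃_k = B_{k,0}x₀ + B_{k,1}x₁, one has B̃₁ = [[x₀,x₀],[x₁,x₁]], B̃₂ = [[x₀,-x₀],[x₁,-x₁]], ĩ = (x₀,x₁)ᵀ, j̃ = (-2x₁, 2x₀)). Then: (1) x satisfies the ADHM equations; (2) x is stable; (3) x is costable; and (4) for every (a,b) ∈ k² with (a,b) ≠ (0,0), the evaluated datum x(a,b) is neither stable nor costable. In particular x is a regular ADHM datum which is not FJ-semistable. -/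
open Matrix

theorem span_singleton_ne_top {k : Type*} [Field k] (v : Fin 2 → k) : Submodule.span k {v} ≠ ⊤ := by
  intro h
  have hle := finrank_span_le_card (R := k) ({v} : Set (Fin 2 → k))
  rw [h, finrank_top, Module.finrank_fin_fun] at hle
  simp at hle

/-- A linear map of the form `x ↦ f x • v` has range in the line through `v`. -/
theorem range_le_span_singleton {k M : Type*} [Field k] [AddCommGroup M] [Module k M]
    {v : Fin 2 → k} (T : M →ₗ[k] Fin 2 → k) (f : M → k) (hT : ∀ x, T x = f x • v) :
    LinearMap.range T ≤ Submodule.span k {v} := by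
  rintro _ ⟨x, rfl⟩
  exact Submodule.mem_span_singleton.2 ⟨f x, (hT x).symm⟩

/-- over a field of characteristic `≠ 2`, the explicit ADHM datum for `ℙ¹`
with `B̃₁ = [[x₀,x₀],[x₁,x₁]]`, `B̃₂ = [[x₀,-x₀],[x₁,-x₁]]`, `ĩ = (x₀,x₁)ᵀ`,
`j̃ = (-2x₁, 2x₀)` satisfies the ADHM equations, is stable and costable (regular),
but its evaluation at every point `(a,b) ≠ (0,0)` is neither stable nor costable;
in particular it is not FJ-semistable. -/
theorem regular_not_FJ_semistable_example {k : Type*} [Field k] (h2 : (2 : k) ≠ 0) :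
    let B10 : Matrix (Fin 2) (Fin 2) k := !![1, 1; 0, 0]
    let B11 : Matrix (Fin 2) (Fin 2) k := !![0, 0; 1, 1]
    let B20 : Matrix (Fin 2) (Fin 2) k := !![1, -1; 0, 0]
    let B21 : Matrix (Fin 2) (Fin 2) k := !![0, 0; 1, -1]
    let i0 : Matrix (Fin 2) (Fin 1) k := !![1; 0]
    let i1 : Matrix (Fin 2) (Fin 1) k := !![0; 1]
    let j0 : Matrix (Fin 1) (Fin 2) k := !![0, 2]
    let j1 : Matrix (Fin 1) (Fin 2) k := !![-2, 0]
    -- (1) the ADHM equations hold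
    (B10 * B20 - B20 * B10 + i0 * j0 = 0 ∧
     B10 * B21 - B21 * B10 + B11 * B20 - B20 * B11 + i0 * j1 + i1 * j0 = 0 ∧
     B11 * B21 - B21 * B11 + i1 * j1 = 0) ∧
    -- (2) the datum is stable
    (∀ S : Submodule k (Fin 2 → k), S ≠ ⊤ →
      S.map (Matrix.toLin' B10) ≤ S → S.map (Matrix.toLin' B11) ≤ S →
      S.map (Matrix.toLin' B20) ≤ S → S.map (Matrix.toLin' B21) ≤ S →
      ¬(LinearMap.range (Matrix.toLin' i0) ≤ S ∧
        LinearMap.range (Matrix.toLin' i1) ≤ S)) ∧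
    -- (3) the datum is costable
    (∀ S : Submodule k (Fin 2 → k), S ≠ ⊥ →
      S.map (Matrix.toLin' B10) ≤ S → S.map (Matrix.toLin' B11) ≤ S →
      S.map (Matrix.toLin' B20) ≤ S → S.map (Matrix.toLin' B21) ≤ S →
      ¬(S ≤ LinearMap.ker (Matrix.toLin' j0) ⊓ LinearMap.ker (Matrix.toLin' j1))) ∧
    -- (4) at every point `(a,b) ≠ (0,0)` the evaluated datum is neither stable
    -- nor costable
    (∀ a b : k, (a, b) ≠ (0, 0) →
      ¬(∀ S : Submodule k (Fin 2 → k), S ≠ ⊤ →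
          S.map (Matrix.toLin' (a • B10 + b • B11)) ≤ S →
          S.map (Matrix.toLin' (a • B20 + b • B21)) ≤ S →
          ¬(LinearMap.range (Matrix.toLin' (a • i0 + b • i1)) ≤ S)) ∧
      ¬(∀ S : Submodule k (Fin 2 → k), S ≠ ⊥ →
          S.map (Matrix.toLin' (a • B10 + b • B11)) ≤ S →
          S.map (Matrix.toLin' (a • B20 + b • B21)) ≤ S →
          ¬(S ≤ LinearMap.ker (Matrix.toLin' (a • j0 + b • j1))))) := by
  intro B10 B11 B20 B21 i0 i1 j0 j1
  refine ⟨⟨?_, ?_, ?_⟩, ?_, ?_, ?_⟩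
  · ext r s
    fin_cases r <;> fin_cases s <;> simp [B10, B20, i0, j0] <;> ring
  · ext r s
    fin_cases r <;> fin_cases s <;> simp [B10, B20, B11, B21, i0, i1, j0, j1] <;> ring
  · ext r s
    fin_cases r <;> fin_cases s <;> simp [B11, B21, i1, j1] <;> ring
  · rintro S hS - - - - ⟨hi0, hi1⟩
    refine hS (eq_top_iff.2 fun x _ => ?_)
    have hx : x = toLin' i0 ![x 0] + toLin' i1 ![x 1] := by
      ext r
      fin_cases r <;> simp [i0, i1]
    rw [hx]
    exact S.add_mem (hi0 ⟨_, rfl⟩) (hi1 ⟨_, rfl⟩)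
  · intro S hS _ _ _ _ hker
    refine hS (eq_bot_iff.2 fun x hx => ?_)
    obtain ⟨hj0, hj1⟩ := hker hx
    have hx1 : x 1 = 0 := by simpa [j0, h2, vecHead, vecTail] using hj0
    have hx0 : x 0 = 0 := by simpa [j1, h2, vecHead] using hj1
    ext r
    fin_cases r <;> simp [hx0, hx1]
  · intro a b hab
    have hB1 : LinearMap.range (toLin' (a • B10 + b • B11)) ≤ Submodule.span k {![a, b]} :=
      range_le_span_singleton _ (fun x => x 0 + x 1) fun x => by
        ext r
        fin_cases r <;> simp [B10, B11, mulVec, dotProduct, Fin.sum_univ_two] <;> ring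
    have hB2 : LinearMap.range (toLin' (a • B20 + b • B21)) ≤ Submodule.span k {![a, b]} :=
      range_le_span_singleton _ (fun x => x 0 - x 1) fun x => by
        ext r
        fin_cases r <;> simp [B20, B21, mulVec, dotProduct, Fin.sum_univ_two] <;> ring
    have hi : LinearMap.range (toLin' (a • i0 + b • i1)) ≤ Submodule.span k {![a, b]} :=
      range_le_span_singleton _ (fun x => x 0) fun x => by
        ext r
        fin_cases r <;> simp [i0, i1, mulVec, dotProduct] <;> ring
    have hj : Submodule.span k {![a, b]} ≤ LinearMap.ker (toLin' (a • j0 + b • j1)) := by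
      rw [Submodule.span_singleton_le_iff_mem, LinearMap.mem_ker]
      ext r
      fin_cases r
      simp [j0, j1, mulVec, dotProduct, Fin.sum_univ_two]
      ring
    have hne : Submodule.span k {![a, b]} ≠ ⊥ := by
      rw [Ne, Submodule.span_singleton_eq_bot]
      intro h
      exact hab (Prod.ext (congrFun h 0) (congrFun h 1))
    exact ⟨fun h => h _ (span_singleton_ne_top _) (LinearMap.map_le_range.trans hB1)
        (LinearMap.map_le_range.trans hB2) hi,
      fun h => h _ hne (LinearMap.map_le_range.trans hB1) (LinearMap.map_le_range.trans hB2) hj⟩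
end

section
/- Let k be a field, r ≥ 2, and let x = (x₁,…,x_r), y = (y₁,…,y_r), z = (z₁,…,z_r), w = (w₁,…,w_r) be vectors in k^r such that x and y are linearly independent. Then the 3 × 4r matrix Dμ = [[z₁,…,z_r, 0,…,0, x₁,…,x_r, 0,…,0],[0,…,0, w₁,…,w_r, 0,…,0, y₁,…,y_r],[w₁,…,w_r, z₁,…,z_r, y₁,…,y_r, x₁,…,x_r]] has rank 3. -/
/-- the Jacobian matrix `Dμ` of the charge-one ADHM moment map
`μ(x,y,z,w) = (Σ xₖzₖ, Σ yₖwₖ, Σ (xₖwₖ + yₖzₖ))` at a point where `x` and `y` are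
linearly independent has rank `3`. (Columns are indexed by `Fin 4 × Fin r`, the four
blocks corresponding to the variables `x`, `y`, `z`, `w`.) -/
theorem charge_one_jacobian_rank {k : Type*} [Field k] {r : ℕ} (hr : 2 ≤ r)
    (x y z w : Fin r → k) (hxy : LinearIndependent k ![x, y]) :
    (Matrix.of fun (i : Fin 3) (q : Fin 4 × Fin r) =>
      if i = 0 then (if q.1 = 0 then z q.2 else if q.1 = 2 then x q.2 else 0)
      else if i = 1 then (if q.1 = 1 then w q.2 else if q.1 = 3 then y q.2 else 0)
      else (if q.1 = 0 then w q.2 else if q.1 = 1 then z q.2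
            else if q.1 = 2 then y q.2 else x q.2)).rank = 3 := by
  rw [LinearIndependent.pair_iff] at hxy
  rw [LinearIndependent.rank_matrix, Fintype.card_fin]
  rw [Fintype.linearIndependent_iff]
  intro g hg
  have hz : g 0 • x + g 2 • y = 0 := by
    ext j
    simpa [Fin.sum_univ_three, Matrix.row] using congrFun hg (2, j)
  have hw : g 2 • x + g 1 • y = 0 := by
    ext j
    simpa [Fin.sum_univ_three, Matrix.row, add_comm] using congrFun hg (3, j)
  obtain ⟨h0, h2⟩ := hxy _ _ hz
  obtain ⟨-, h1⟩ := hxy _ _ hw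
  intro i
  fin_cases i
  exacts [h0, h1, h2]
end

section
/- Let V, W be finite-dimensional ℂ-vector spaces and let B̃ be the space of (not necessarily equation-satisfying) ADHM tuples for ℙ¹, whose elements are written as pairs of rows x = ((B₁₁,B₁₂,i₁,j₁),(B₂₁,B₂₂,i₂,j₂)). Define the bilinear form g on B̃ by g(x,x') = Tr(B₁₁B'₂₂ + B₂₂B'₁₁ − B₂₁B'₁₂ − B₁₂B'₂₁ + i₁j'₂ + i'₁j₂ − i₂j'₁ − i'₂j₁), and let I, J, K be the linear operators on B̃ acting on the row index by the matrices I = [[√−1,0],[0,−√−1]], J = [[0,1],[−1,0]], K = [[0,√−1],[√−1,0]] (i.e. for such a 2×2 matrix M, the l-th row of M·x is m_{l1}·row₁(x) + m_{l2}·row₂(x)). Then: (1) g is a nondegenerate symmetric bilinear form on B̃; (2) I² = J² = K² = I∘J∘K = −id; (3) g(Iv,Iw) = g(Jv,Jw) = g(Kv,Kw) = g(v,w) for all v,w ∈ B̃. That is, (g,I,J,K) is a hypersymplectic structure on B̃. -/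
open Matrix

/-- The space `B̃` of ADHM tuples for `ℙ¹` (with `V = ℂⁿ`, `W = ℂᵐ`), written as pairs of
rows: row `l` is the quadruple `(B_{l+1,1}, B_{l+1,2}, i_{l+1}, j_{l+1})`. -/
abbrev HADHMSpace (n m : ℕ) := Fin 2 →
  Matrix (Fin n) (Fin n) ℂ × Matrix (Fin n) (Fin n) ℂ ×
  Matrix (Fin n) (Fin m) ℂ × Matrix (Fin m) (Fin n) ℂ

/-- The symmetric form `g(x,x') = Tr(B₁₁B'₂₂ + B₂₂B'₁₁ − B₂₁B'₁₂ − B₁₂B'₂₁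
+ i₁j'₂ + i'₁j₂ − i₂j'₁ − i'₂j₁)` on `B̃`. -/
noncomputable def hForm {n m : ℕ} (x x' : HADHMSpace n m) : ℂ :=
  Matrix.trace
    ((x 0).1 * (x' 1).2.1 + (x 1).2.1 * (x' 0).1
      - (x 1).1 * (x' 0).2.1 - (x 0).2.1 * (x' 1).1
      + (x 0).2.2.1 * (x' 1).2.2.2 + (x' 0).2.2.1 * (x 1).2.2.2
      - (x 1).2.2.1 * (x' 0).2.2.2 - (x' 1).2.2.1 * (x 0).2.2.2)

/-- The action of a `2 × 2` complex matrix on the row index of an element of `B̃`. -/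
noncomputable def rowAct {n m : ℕ} (M : Matrix (Fin 2) (Fin 2) ℂ) (x : HADHMSpace n m) :
    HADHMSpace n m :=
  fun l => M l 0 • x 0 + M l 1 • x 1

/-- The operator `I`. -/
noncomputable def Iop {n m : ℕ} : HADHMSpace n m → HADHMSpace n m :=
  rowAct !![Complex.I, 0; 0, -Complex.I]

/-- The operator `J`. -/
noncomputable def Jop {n m : ℕ} : HADHMSpace n m → HADHMSpace n m :=
  rowAct !![0, 1; -1, 0]

/-- The operator `K`. -/
noncomputable def Kop {n m : ℕ} : HADHMSpace n m → HADHMSpace n m :=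
  rowAct !![0, Complex.I; Complex.I, 0]

/-- `rowAct` is a left action of the monoid of `2 × 2` matrices. -/
lemma rowAct_rowAct {n m : ℕ} (M N : Matrix (Fin 2) (Fin 2) ℂ) (x : HADHMSpace n m) :
    rowAct M (rowAct N x) = rowAct (M * N) x := by
  funext l
  simp only [rowAct, Matrix.mul_apply, Fin.sum_univ_two]
  module

lemma rowAct_neg_one {n m : ℕ} (x : HADHMSpace n m) : rowAct (-1) x = -x := by
  funext l
  fin_cases l <;> simp [rowAct]

/-- The form `hForm` is multiplied by the determinant under the row action. -/
lemma hForm_rowAct {n m : ℕ} (M : Matrix (Fin 2) (Fin 2) ℂ) (x y : HADHMSpace n m) :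
    hForm (rowAct M x) (rowAct M y) = M.det * hForm x y := by
  simp only [hForm, rowAct, Matrix.det_fin_two, Prod.fst_add, Prod.snd_add, Prod.smul_fst,
    Prod.smul_snd, Matrix.add_mul, Matrix.mul_add, Matrix.smul_mul, Matrix.mul_smul,
    Matrix.trace_add, Matrix.trace_sub, Matrix.trace_smul, smul_eq_mul]
  ring

lemma hForm_smul_add_left {n m : ℕ} (a : ℂ) (x y z : HADHMSpace n m) :
    hForm (a • x + y) z = a * hForm x z + hForm y z := by
  simp only [hForm, Pi.add_apply, Pi.smul_apply, Prod.fst_add, Prod.snd_add, Prod.smul_fst,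
    Prod.smul_snd, Matrix.add_mul, Matrix.mul_add, Matrix.smul_mul, Matrix.mul_smul,
    Matrix.trace_add, Matrix.trace_sub, Matrix.trace_smul, smul_eq_mul]
  ring

lemma hForm_comm {n m : ℕ} (x y : HADHMSpace n m) : hForm x y = hForm y x := by
  simp only [hForm, Matrix.trace_add, Matrix.trace_sub]
  rw [Matrix.trace_mul_comm (x 0).1, Matrix.trace_mul_comm (x 1).2.1,
    Matrix.trace_mul_comm (x 1).1, Matrix.trace_mul_comm (x 0).2.1]
  ring

lemma eq_zero_of_hForm_eq_zero {n m : ℕ} (x : HADHMSpace n m) (h : ∀ y, hForm x y = 0) :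
    x = 0 := by
  have key (b c b' c' i j i' j') := h ![(b, c, i, j), (b', c', i', j')]
  simp only [hForm, Matrix.cons_val_zero, Matrix.cons_val_one] at key
  have h₁ : (x 0).1 = 0 := Matrix.ext_iff_trace_mul_right.2 fun y => by
    simpa using key 0 0 0 y 0 0 0 0
  have h₂ : (x 0).2.1 = 0 := Matrix.ext_iff_trace_mul_right.2 fun y => by
    simpa using key 0 0 y 0 0 0 0 0
  have h₃ : (x 0).2.2.1 = 0 := Matrix.ext_iff_trace_mul_right.2 fun y => by
    simpa using key 0 0 0 0 0 0 0 y
  have h₄ : (x 0).2.2.2 = 0 := Matrix.ext_iff_trace_mul_left.2 fun y => by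
    simpa using key 0 0 0 0 0 0 y 0
  have h₅ : (x 1).1 = 0 := Matrix.ext_iff_trace_mul_right.2 fun y => by
    simpa using key 0 y 0 0 0 0 0 0
  have h₆ : (x 1).2.1 = 0 := Matrix.ext_iff_trace_mul_right.2 fun y => by
    simpa using key y 0 0 0 0 0 0 0
  have h₇ : (x 1).2.2.1 = 0 := Matrix.ext_iff_trace_mul_right.2 fun y => by
    simpa using key 0 0 0 0 0 y 0 0
  have h₈ : (x 1).2.2.2 = 0 := Matrix.ext_iff_trace_mul_left.2 fun y => by
    simpa using key 0 0 0 0 y 0 0 0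
  funext l
  fin_cases l
  · exact Prod.ext h₁ (Prod.ext h₂ (Prod.ext h₃ h₄))
  · exact Prod.ext h₅ (Prod.ext h₆ (Prod.ext h₇ h₈))

/-- `(g, I, J, K)` is a hypersymplectic structure on `B̃`: `g` is a
nondegenerate symmetric bilinear form, `I² = J² = K² = IJK = −1`, and `I`, `J`, `K`
preserve `g`. -/
theorem hypersymplectic_structure_on_ADHM_space {n m : ℕ} :
    -- (1a) `g` is bilinear (linearity in the first argument; by symmetry in both)
    (∀ (a : ℂ) (x y z : HADHMSpace n m),
        hForm (a • x + y) z = a * hForm x z + hForm y z) ∧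
    -- (1b) `g` is symmetric
    (∀ x y : HADHMSpace n m, hForm x y = hForm y x) ∧
    -- (1c) `g` is nondegenerate
    (∀ x : HADHMSpace n m, (∀ y, hForm x y = 0) → x = 0) ∧
    -- (2) quaternion relations
    (∀ x : HADHMSpace n m, Iop (Iop x) = -x) ∧
    (∀ x : HADHMSpace n m, Jop (Jop x) = -x) ∧
    (∀ x : HADHMSpace n m, Kop (Kop x) = -x) ∧
    (∀ x : HADHMSpace n m, Iop (Jop (Kop x)) = -x) ∧
    -- (3) `I`, `J`, `K` preserve `g`
    (∀ v w : HADHMSpace n m, hForm (Iop v) (Iop w) = hForm v w) ∧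
    (∀ v w : HADHMSpace n m, hForm (Jop v) (Jop w) = hForm v w) ∧
    (∀ v w : HADHMSpace n m, hForm (Kop v) (Kop w) = hForm v w) := by
  refine ⟨hForm_smul_add_left, hForm_comm, eq_zero_of_hForm_eq_zero, fun x => ?_, fun x => ?_,
    fun x => ?_, fun x => ?_, fun v w => ?_, fun v w => ?_, fun v w => ?_⟩
  iterate 4
    · simp only [Iop, Jop, Kop, rowAct_rowAct]
      rw [← rowAct_neg_one]
      congr 1
      ext i j
      fin_cases i <;> fin_cases j <;> simp
  all_goals simp [Iop, Jop, Kop, hForm_rowAct, Matrix.det_fin_two]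
end

section
/- With the hypersymplectic structure (g,I,J,K) on B̃ over ℂ as defined, write the moment map μ̃ : B̃ → End(V)³ as μ̃(x) = (μ₁(x), μ₂(x), μ₃(x)) with μ₁(x) = [B₁₁,B₁₂] + i₁j₁, μ₂(x) = [B₁₁,B₂₂] + [B₂₁,B₁₂] + i₁j₂ + i₂j₁, μ₃(x) = [B₂₁,B₂₂] + i₂j₂, and set μ̃₁ = √−1·μ₂, μ̃₂ = μ₁ + μ₃, μ̃₃ = √−1·(μ₃ − μ₁). For ξ ∈ End(V) and x ∈ B̃ set ξ_x = (([ξ,B₁₁],[ξ,B₁₂], ξi₁, −j₁ξ), ([ξ,B₂₁],[ξ,B₂₂], ξi₂, −j₂ξ)), and define the derivative dμ̃_{l,x}(v) = μ̃_l(x+v) − μ̃_l(x) − μ̃_l(v). Then for l = 1,2,3: (1) μ̃_l(g·x) = g·μ̃_l(x)·g⁻¹ for all g ∈ GL(V) (equivariance for the adjoint action); and (2) Tr(dμ̃_{l,x}(v)·ξ) = ω_l(ξ_x, v) for all x, v ∈ B̃ and all ξ ∈ End(V), where ω₁(u,v) = g(Iu,v), ω₂(u,v) = g(Ju,v), ω₃(u,v)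 = g(Ku,v). That is, μ̃ = (μ̃₁,μ̃₂,μ̃₃) is a hypersymplectic moment map for the GL(V)-action on B̃. -/
open Matrix

/-- `μ₁(x) = [B₁₁, B₁₂] + i₁j₁`. -/
noncomputable def mu1 {n m : ℕ} (x : HADHMSpace n m) : Matrix (Fin n) (Fin n) ℂ :=
  (x 0).1 * (x 0).2.1 - (x 0).2.1 * (x 0).1 + (x 0).2.2.1 * (x 0).2.2.2

/-- `μ₂(x) = [B₁₁, B₂₂] + [B₂₁, B₁₂] + i₁j₂ + i₂j₁`. -/
noncomputable def mu2 {n m : ℕ} (x : HADHMSpace n m) : Matrix (Fin n) (Fin n) ℂ :=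
  (x 0).1 * (x 1).2.1 - (x 1).2.1 * (x 0).1
    + (x 1).1 * (x 0).2.1 - (x 0).2.1 * (x 1).1
    + (x 0).2.2.1 * (x 1).2.2.2 + (x 1).2.2.1 * (x 0).2.2.2

/-- `μ₃(x) = [B₂₁, B₂₂] + i₂j₂`. -/
noncomputable def mu3 {n m : ℕ} (x : HADHMSpace n m) : Matrix (Fin n) (Fin n) ℂ :=
  (x 1).1 * (x 1).2.1 - (x 1).2.1 * (x 1).1 + (x 1).2.2.1 * (x 1).2.2.2

/-- `μ̃₁ = √−1 · μ₂`. -/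
noncomputable def mut1 {n m : ℕ} (x : HADHMSpace n m) : Matrix (Fin n) (Fin n) ℂ :=
  Complex.I • mu2 x

/-- `μ̃₂ = μ₁ + μ₃`. -/
noncomputable def mut2 {n m : ℕ} (x : HADHMSpace n m) : Matrix (Fin n) (Fin n) ℂ :=
  mu1 x + mu3 x

/-- `μ̃₃ = √−1 · (μ₃ − μ₁)`. -/
noncomputable def mut3 {n m : ℕ} (x : HADHMSpace n m) : Matrix (Fin n) (Fin n) ℂ :=
  Complex.I • (mu3 x - mu1 x)

/-- The action of `g ∈ GL(V)` on `B̃`. -/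
noncomputable def hAct {n m : ℕ} (g : (Matrix (Fin n) (Fin n) ℂ)ˣ)
    (x : HADHMSpace n m) : HADHMSpace n m :=
  fun l =>
    ((g : Matrix (Fin n) (Fin n) ℂ) * (x l).1 *
        ((g⁻¹ : (Matrix (Fin n) (Fin n) ℂ)ˣ) : Matrix (Fin n) (Fin n) ℂ),
     (g : Matrix (Fin n) (Fin n) ℂ) * (x l).2.1 *
        ((g⁻¹ : (Matrix (Fin n) (Fin n) ℂ)ˣ) : Matrix (Fin n) (Fin n) ℂ),
     (g : Matrix (Fin n) (Fin n) ℂ) * (x l).2.2.1,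
     (x l).2.2.2 * ((g⁻¹ : (Matrix (Fin n) (Fin n) ℂ)ˣ) : Matrix (Fin n) (Fin n) ℂ))

/-- The infinitesimal action `ξ_x` of `ξ ∈ 𝔤𝔩(V)` at `x ∈ B̃`:
`ξ_x = (([ξ,B_{l1}], [ξ,B_{l2}], ξ i_l, −j_l ξ))_{l=1,2}`. -/
noncomputable def xiAt {n m : ℕ} (ξ : Matrix (Fin n) (Fin n) ℂ) (x : HADHMSpace n m) :
    HADHMSpace n m :=
  fun l => (ξ * (x l).1 - (x l).1 * ξ, ξ * (x l).2.1 - (x l).2.1 * ξ,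
            ξ * (x l).2.2.1, -((x l).2.2.2 * ξ))

/-- The space of one row `(B₁, B₂, i, j)` of an ADHM tuple. -/
abbrev ADHMRow (n m : ℕ) :=
  Matrix (Fin n) (Fin n) ℂ × Matrix (Fin n) (Fin n) ℂ ×
  Matrix (Fin n) (Fin m) ℂ × Matrix (Fin m) (Fin n) ℂ

/-- The bilinear map on rows whose diagonal is the complex ADHM moment map
`[B₁, B₂] + ij`. -/
noncomputable def rowMoment {n m : ℕ} (a b : ADHMRow n m) : Matrix (Fin n) (Fin n) ℂ :=
  a.1 * b.2.1 - b.2.1 * a.1 + a.2.2.1 * b.2.2.2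

/-- The complex symplectic form on rows. -/
noncomputable def rowForm {n m : ℕ} (a b : ADHMRow n m) : ℂ :=
  Matrix.trace (a.1 * b.2.1 - a.2.1 * b.1 + a.2.2.1 * b.2.2.2 - b.2.2.1 * a.2.2.2)

lemma rowMoment_add_left {n m : ℕ} (a a' b : ADHMRow n m) :
    rowMoment (a + a') b = rowMoment a b + rowMoment a' b := by
  simp only [rowMoment, Prod.fst_add, Prod.snd_add, Matrix.add_mul, Matrix.mul_add]
  abel

lemma rowMoment_add_right {n m : ℕ} (a b b' : ADHMRow n m) :
    rowMoment a (b + b') = rowMoment a b + rowMoment a b' := by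
  simp only [rowMoment, Prod.fst_add, Prod.snd_add, Matrix.add_mul, Matrix.mul_add]
  abel

lemma mu1_eq_rowMoment {n m : ℕ} (x : HADHMSpace n m) : mu1 x = rowMoment (x 0) (x 0) := rfl

lemma mu2_eq_rowMoment {n m : ℕ} (x : HADHMSpace n m) :
    mu2 x = rowMoment (x 0) (x 1) + rowMoment (x 1) (x 0) := by
  simp only [mu2, rowMoment]
  abel

lemma mu3_eq_rowMoment {n m : ℕ} (x : HADHMSpace n m) : mu3 x = rowMoment (x 1) (x 1) := rfl

lemma hForm_eq_rowForm {n m : ℕ} (x y : HADHMSpace n m) :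
    hForm x y = rowForm (x 0) (y 1) - rowForm (x 1) (y 0) := by
  simp only [hForm, rowForm, Matrix.trace_add, Matrix.trace_sub]
  ring

lemma rowForm_smul_left {n m : ℕ} (c : ℂ) (a b : ADHMRow n m) :
    rowForm (c • a) b = c * rowForm a b := by
  simp only [rowForm, Prod.smul_fst, Prod.smul_snd, Matrix.smul_mul, Matrix.mul_smul,
    Matrix.trace_add, Matrix.trace_sub, Matrix.trace_smul, smul_eq_mul]
  ring

lemma rowForm_neg_left {n m : ℕ} (a b : ADHMRow n m) : rowForm (-a) b = -rowForm a b := by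
  simpa using rowForm_smul_left (-1) a b

lemma rowMoment_hAct {n m : ℕ} (g : (Matrix (Fin n) (Fin n) ℂ)ˣ) (x : HADHMSpace n m)
    (k l : Fin 2) :
    rowMoment (hAct g x k) (hAct g x l) = (g : Matrix (Fin n) (Fin n) ℂ) *
      rowMoment (x k) (x l) * ((g⁻¹ : (Matrix (Fin n) (Fin n) ℂ)ˣ) : Matrix (Fin n) (Fin n) ℂ) := by
  have cancel (A : Matrix (Fin n) (Fin n) ℂ) :
      ((g⁻¹ : (Matrix (Fin n) (Fin n) ℂ)ˣ) : Matrix (Fin n) (Fin n) ℂ) *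
        ((g : Matrix (Fin n) (Fin n) ℂ) * A) = A := g.inv_mul_cancel_left A
  simp only [rowMoment, hAct, Matrix.mul_assoc, cancel, Matrix.mul_add, Matrix.mul_sub,
    Matrix.add_mul, Matrix.sub_mul]

/-- The moment map identity for rows, polarised. -/
lemma trace_rowMoment_mul {n m : ℕ} (ξ : Matrix (Fin n) (Fin n) ℂ) (x : HADHMSpace n m)
    (k : Fin 2) (b : ADHMRow n m) :
    Matrix.trace (rowMoment (x k) b * ξ) + Matrix.trace (rowMoment b (x k) * ξ) =
      rowForm (xiAt ξ x k) b := by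
  simp only [rowMoment, rowForm, xiAt, Matrix.add_mul, Matrix.sub_mul, Matrix.mul_neg,
    Matrix.trace_add, Matrix.trace_sub, Matrix.trace_neg, ← Matrix.mul_assoc]
  rw [Matrix.trace_mul_cycle (x k).1 b.2.1 ξ, Matrix.trace_mul_cycle b.2.1 (x k).1 ξ,
    Matrix.trace_mul_cycle (x k).2.2.1 b.2.2.2 ξ, Matrix.trace_mul_cycle b.1 (x k).2.1 ξ,
    Matrix.trace_mul_cycle (x k).2.1 b.1 ξ, Matrix.trace_mul_cycle ξ b.2.1 (x k).1,
    Matrix.trace_mul_cycle ξ b.1 (x k).2.1]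
  ring

/-- `μ̃ = (μ̃₁, μ̃₂, μ̃₃)` is a hypersymplectic moment map for the
`GL(V)`-action on `B̃`: each `μ̃_l` is equivariant for the adjoint action, and for
the derivatives `dμ̃_{l,x}(v) = μ̃_l(x+v) − μ̃_l(x) − μ̃_l(v)` one has
`Tr(dμ̃_{l,x}(v)·ξ) = ω_l(ξ_x, v)` with `ω₁ = g(I·,·)`, `ω₂ = g(J·,·)`,
`ω₃ = g(K·,·)`. -/
theorem hypersymplectic_moment_map_for_ADHM {n m : ℕ} :
    -- (1) equivariance
    (∀ (g : (Matrix (Fin n) (Fin n) ℂ)ˣ) (x : HADHMSpace n m),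
      mut1 (hAct g x) = (g : Matrix (Fin n) (Fin n) ℂ) * mut1 x *
        ((g⁻¹ : (Matrix (Fin n) (Fin n) ℂ)ˣ) : Matrix (Fin n) (Fin n) ℂ)) ∧
    (∀ (g : (Matrix (Fin n) (Fin n) ℂ)ˣ) (x : HADHMSpace n m),
      mut2 (hAct g x) = (g : Matrix (Fin n) (Fin n) ℂ) * mut2 x *
        ((g⁻¹ : (Matrix (Fin n) (Fin n) ℂ)ˣ) : Matrix (Fin n) (Fin n) ℂ)) ∧
    (∀ (g : (Matrix (Fin n) (Fin n) ℂ)ˣ) (x : HADHMSpace n m),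
      mut3 (hAct g x) = (g : Matrix (Fin n) (Fin n) ℂ) * mut3 x *
        ((g⁻¹ : (Matrix (Fin n) (Fin n) ℂ)ˣ) : Matrix (Fin n) (Fin n) ℂ)) ∧
    -- (2) the moment map property
    (∀ (x v : HADHMSpace n m) (ξ : Matrix (Fin n) (Fin n) ℂ),
      Matrix.trace ((mut1 (x + v) - mut1 x - mut1 v) * ξ) =
        hForm (Iop (xiAt ξ x)) v) ∧
    (∀ (x v : HADHMSpace n m) (ξ : Matrix (Fin n) (Fin n) ℂ),
      Matrix.trace ((mut2 (x + v) - mut2 x - mut2 v) * ξ) =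
        hForm (Jop (xiAt ξ x)) v) ∧
    (∀ (x v : HADHMSpace n m) (ξ : Matrix (Fin n) (Fin n) ℂ),
      Matrix.trace ((mut3 (x + v) - mut3 x - mut3 v) * ξ) =
        hForm (Kop (xiAt ξ x)) v) := by
  refine ⟨fun g x => ?_, fun g x => ?_, fun g x => ?_, fun x v ξ => ?_, fun x v ξ => ?_,
    fun x v ξ => ?_⟩
  · simp only [mut1, mu2_eq_rowMoment, rowMoment_hAct, Matrix.mul_add, Matrix.add_mul,
      Matrix.mul_smul, Matrix.smul_mul]
  · simp only [mut2, mu1_eq_rowMoment, mu3_eq_rowMoment, rowMoment_hAct, Matrix.mul_add,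
      Matrix.add_mul]
  · simp only [mut3, mu1_eq_rowMoment, mu3_eq_rowMoment, rowMoment_hAct, Matrix.mul_sub,
      Matrix.sub_mul, Matrix.mul_smul, Matrix.smul_mul]
  · have h0 : Iop (xiAt ξ x) 0 = Complex.I • xiAt ξ x 0 := by simp [Iop, rowAct]
    have h1 : Iop (xiAt ξ x) 1 = -(Complex.I • xiAt ξ x 1) := by simp [Iop, rowAct]
    rw [hForm_eq_rowForm, h0, h1, rowForm_neg_left, rowForm_smul_left, rowForm_smul_left,
      ← trace_rowMoment_mul, ← trace_rowMoment_mul]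
    simp only [mut1, mu2_eq_rowMoment, Pi.add_apply, rowMoment_add_left, rowMoment_add_right,
      Matrix.sub_mul, Matrix.smul_mul, Matrix.add_mul, Matrix.trace_sub, Matrix.trace_smul,
      Matrix.trace_add, smul_eq_mul]
    ring
  · have h0 : Jop (xiAt ξ x) 0 = xiAt ξ x 1 := by simp [Jop, rowAct]
    have h1 : Jop (xiAt ξ x) 1 = -xiAt ξ x 0 := by simp [Jop, rowAct]
    rw [hForm_eq_rowForm, h0, h1, rowForm_neg_left, ← trace_rowMoment_mul,
      ← trace_rowMoment_mul]
    simp only [mut2, mu1_eq_rowMoment, mu3_eq_rowMoment, Pi.add_apply, rowMoment_add_left,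
      rowMoment_add_right, Matrix.sub_mul, Matrix.add_mul, Matrix.trace_sub, Matrix.trace_add]
    ring
  · have h0 : Kop (xiAt ξ x) 0 = Complex.I • xiAt ξ x 1 := by simp [Kop, rowAct]
    have h1 : Kop (xiAt ξ x) 1 = Complex.I • xiAt ξ x 0 := by simp [Kop, rowAct]
    rw [hForm_eq_rowForm, h0, h1, rowForm_smul_left, rowForm_smul_left,
      ← trace_rowMoment_mul, ← trace_rowMoment_mul]
    simp only [mut3, mu1_eq_rowMoment, mu3_eq_rowMoment, Pi.add_apply, rowMoment_add_left,
      rowMoment_add_right, Matrix.sub_mul, Matrix.smul_mul, Matrix.add_mul, Matrix.trace_sub,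
      Matrix.trace_smul, Matrix.trace_add, smul_eq_mul]
    ring
end

section
/- Let T be a finite-dimensional vector space over a field k equipped with a nondegenerate symmetric bilinear form g and linear operators I, J, K on T satisfying I² = J² = K² = I∘J∘K = −id and g(Iv,Iw) = g(Jv,Jw) = g(Kv,Kw) = g(v,w) for all v,w. Let 𝔤 be a finite-dimensional k-vector space, let φ : 𝔤 → T be a linear map, and define ν : T → (𝔤*)³ by ν(v) = (ξ ↦ g(Iφ(ξ), v), ξ ↦ g(Jφ(ξ), v), ξ ↦ g(Kφ(ξ), v)). Then the following are equivalent: (1) ν is surjective; (2) φ is injective and the subspaces Iφ(𝔤), Jφ(𝔤), Kφ(𝔤) form a direct sum (i.e. their sum has dimension 3·dim φ(𝔤)); (3) the linear map 𝔤 ⊕ 𝔤 ⊕ 𝔤 → T, (ξ₁,ξ₂,ξ₃) ↦ Iφ(ξ₁) + Jφ(ξ₂) + Kφ(ξ₃), is injective. -/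
/-- Three linear maps `A`, `B`, `C` are jointly injective iff any three functionals on their
source are simultaneously represented, through a nondegenerate form, by a single vector. -/
lemma exists_represent_iff_coprod_injective {k T G : Type*} [Field k]
    [AddCommGroup T] [Module k T] [FiniteDimensional k T] [AddCommGroup G] [Module k G]
    (g : T →ₗ[k] T →ₗ[k] k) (hsymm : ∀ v w, g v w = g w v)
    (hnd : ∀ v, (∀ w, g v w = 0) → v = 0) (A B C : G →ₗ[k] T) :
    (∀ η₁ η₂ η₃ : Module.Dual k G, ∃ v : T,
        (∀ ξ, g (A ξ) v = η₁ ξ) ∧ (∀ ξ, g (B ξ) v = η₂ ξ) ∧ (∀ ξ, g (C ξ) v = η₃ ξ)) ↔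
      Function.Injective (A.coprod (B.coprod C)) := by
  constructor
  · intro h
    rw [injective_iff_map_eq_zero]
    rintro ⟨ξ₁, ξ₂, ξ₃⟩ h0
    have key : ∀ η₁ η₂ η₃ : Module.Dual k G, η₁ ξ₁ + (η₂ ξ₂ + η₃ ξ₃) = 0 := by
      intro η₁ η₂ η₃
      obtain ⟨v, h₁, h₂, h₃⟩ := h η₁ η₂ η₃
      rw [← h₁, ← h₂, ← h₃]
      simpa using congrArg (fun t => g t v) h0
    rw [Prod.mk_eq_zero, Prod.mk_eq_zero]
    refine ⟨?_, ?_, ?_⟩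
    · exact (Module.forall_dual_apply_eq_zero_iff k ξ₁).1 fun η => by simpa using key η 0 0
    · exact (Module.forall_dual_apply_eq_zero_iff k ξ₂).1 fun η => by simpa using key 0 η 0
    · exact (Module.forall_dual_apply_eq_zero_iff k ξ₃).1 fun η => by simpa using key 0 0 η
  · intro h η₁ η₂ η₃
    obtain ⟨θ, hθ⟩ := LinearMap.dualMap_surjective_of_injective h (η₁.coprod (η₂.coprod η₃))
    have hinj : Function.Injective g := (injective_iff_map_eq_zero g).2 fun v hv =>
      hnd v fun w => by rw [hv, LinearMap.zero_apply]
    obtain ⟨v, rfl⟩ := (LinearMap.injective_iff_surjective_of_finrank_eq_finrank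
      (Subspace.dual_finrank_eq (K := k) (V := T)).symm).1 hinj θ
    refine ⟨v, fun ξ => ?_, fun ξ => ?_, fun ξ => ?_⟩ <;> rw [hsymm]
    · simpa using LinearMap.congr_fun hθ (ξ, 0, 0)
    · simpa using LinearMap.congr_fun hθ (0, ξ, 0)
    · simpa using LinearMap.congr_fun hθ (0, 0, ξ)

lemma LinearMap.injective_iff_finrank_range_eq {k V W : Type*} [Field k]
    [AddCommGroup V] [Module k V] [FiniteDimensional k V] [AddCommGroup W] [Module k W]
    (f : V →ₗ[k] W) :
    Function.Injective f ↔ Module.finrank k (LinearMap.range f) = Module.finrank k V := by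
  refine ⟨LinearMap.finrank_range_of_inj, fun h => ?_⟩
  have := f.finrank_range_add_finrank_ker
  rw [← LinearMap.ker_eq_bot, ← Submodule.finrank_eq_zero (R := k)]
  omega


/-- pointwise criterion for surjectivity of the differential of a
hypersymplectic moment map. Given a hypersymplectic structure `(g, I, J, K)` on a
finite-dimensional space `T`, a linear map `φ : 𝔤 → T`, and
`ν : T → (𝔤*)³`, `ν(v) = (ξ ↦ g(Iφξ, v), ξ ↦ g(Jφξ, v), ξ ↦ g(Kφξ, v))`,
the following are equivalent: (1) `ν` is surjective; (2) `φ` is injective and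
`Iφ(𝔤) + Jφ(𝔤) + Kφ(𝔤)` is a direct sum (its dimension is `3·dim φ(𝔤)`);
(3) `(ξ₁,ξ₂,ξ₃) ↦ Iφξ₁ + Jφξ₂ + Kφξ₃` is injective. -/
theorem moment_map_differential_surjectivity_criterion
    {k T G : Type*} [Field k]
    [AddCommGroup T] [Module k T] [FiniteDimensional k T]
    [AddCommGroup G] [Module k G] [FiniteDimensional k G]
    (g : T →ₗ[k] T →ₗ[k] k)
    (hsymm : ∀ v w, g v w = g w v)
    (hnd : ∀ v, (∀ w, g v w = 0) → v = 0)
    (I J K : T →ₗ[k] T)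
    (hI2 : ∀ v, I (I v) = -v) (hJ2 : ∀ v, J (J v) = -v) (hK2 : ∀ v, K (K v) = -v)
    (hIJK : ∀ v, I (J (K v)) = -v)
    (hgI : ∀ v w, g (I v) (I w) = g v w)
    (hgJ : ∀ v w, g (J v) (J w) = g v w)
    (hgK : ∀ v w, g (K v) (K w) = g v w)
    (φ : G →ₗ[k] T) :
    -- (1) ↔ (2)
    ((∀ η₁ η₂ η₃ : Module.Dual k G, ∃ v : T,
        (∀ ξ, g (I (φ ξ)) v = η₁ ξ) ∧ (∀ ξ, g (J (φ ξ)) v = η₂ ξ) ∧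
        (∀ ξ, g (K (φ ξ)) v = η₃ ξ)) ↔
      (Function.Injective φ ∧
        Module.finrank k
            ((LinearMap.range φ).map I ⊔ (LinearMap.range φ).map J ⊔
              (LinearMap.range φ).map K : Submodule k T) =
          3 * Module.finrank k (LinearMap.range φ))) ∧
    -- (1) ↔ (3)
    ((∀ η₁ η₂ η₃ : Module.Dual k G, ∃ v : T,
        (∀ ξ, g (I (φ ξ)) v = η₁ ξ) ∧ (∀ ξ, g (J (φ ξ)) v = η₂ ξ) ∧
        (∀ ξ, g (K (φ ξ)) v = η₃ ξ)) ↔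
      (∀ ξ₁ ξ₂ ξ₃ : G, I (φ ξ₁) + J (φ ξ₂) + K (φ ξ₃) = 0 →
        ξ₁ = 0 ∧ ξ₂ = 0 ∧ ξ₃ = 0)) := by
  have h13 := exists_represent_iff_coprod_injective g hsymm hnd (I ∘ₗ φ) (J ∘ₗ φ) (K ∘ₗ φ)
  set F := (I ∘ₗ φ).coprod ((J ∘ₗ φ).coprod (K ∘ₗ φ)) with hF
  have hrange : LinearMap.range F = (LinearMap.range φ).map I ⊔ (LinearMap.range φ).map J ⊔
      (LinearMap.range φ).map K := by
    simp only [hF, LinearMap.range_coprod, LinearMap.range_comp, sup_assoc]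
  have hdim : Module.finrank k (G × G × G) = 3 * Module.finrank k G := by
    rw [Module.finrank_prod, Module.finrank_prod]
    ring
  refine ⟨h13.trans ?_, h13.trans ?_⟩
  · rw [← hrange]
    constructor
    · intro h
      have hφ : Function.Injective φ := (injective_iff_map_eq_zero φ).2 fun ξ hξ =>
        congrArg Prod.fst ((injective_iff_map_eq_zero F).1 h (ξ, 0, 0) (by simp [hF, hξ]))
      exact ⟨hφ, by rw [LinearMap.finrank_range_of_inj h, LinearMap.finrank_range_of_inj hφ, hdim]⟩
    · rintro ⟨hφ, h⟩
      rw [LinearMap.injective_iff_finrank_range_eq, h, LinearMap.finrank_range_of_inj hφ, hdim]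
  · rw [injective_iff_map_eq_zero]
    simp [hF, Prod.forall, add_assoc]
end

section
/- Let T be a finite-dimensional vector space over a field k equipped with a nondegenerate symmetric bilinear form g and linear operators I, J, K on T satisfying I² = J² = K² = I∘J∘K = −id and g(Iv,Iw) = g(Jv,Jw) = g(Kv,Kw) = g(v,w). Let 𝔤 be finite-dimensional, φ : 𝔤 → T an injective linear map, V = φ(𝔤), and define ν : T → (𝔤*)³ by ν(v) = (ξ ↦ g(Iφ(ξ), v), ξ ↦ g(Jφ(ξ), v), ξ ↦ g(Kφ(ξ), v)). Assume that ν vanishes on V (i.e. g(Lφ(ξ), φ(ζ)) = 0 for all ξ, ζ ∈ 𝔤 and L ∈ {I,J,K}) and that the restriction of g to V is nondegenerate. Then ν is surjective. -/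
/-- If a symmetric bilinear form is nondegenerate on the range of an injective linear map `φ`,
every functional on the source of `φ` is represented by an element of that range. -/
theorem exists_apply_eq_of_nondegenerate_on_range
    {k T G : Type*} [Field k] [AddCommGroup T] [Module k T]
    [AddCommGroup G] [Module k G] [FiniteDimensional k G]
    (g : T →ₗ[k] T →ₗ[k] k) (hsymm : ∀ v w, g v w = g w v)
    (φ : G →ₗ[k] T) (hφ : Function.Injective φ)
    (hndV : ∀ v ∈ LinearMap.range φ, (∀ w ∈ LinearMap.range φ, g v w = 0) → v = 0)
    (η : Module.Dual k G) : ∃ a : G, ∀ ξ, g (φ ξ) (φ a) = η ξ := by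
  let B : G →ₗ[k] Module.Dual k G := g.compl₁₂ φ φ
  have hinj : Function.Injective B := by
    refine (injective_iff_map_eq_zero B).2 fun a ha => hφ ?_
    rw [map_zero]
    refine hndV _ ⟨a, rfl⟩ ?_
    rintro _ ⟨ζ, rfl⟩
    exact LinearMap.congr_fun ha ζ
  obtain ⟨a, ha⟩ := (LinearMap.injective_iff_surjective_of_finrank_eq_finrank
    (Subspace.dual_finrank_eq (K := k) (V := G)).symm).1 hinj η
  exact ⟨a, fun ξ => (hsymm _ _).trans (LinearMap.congr_fun ha ξ)⟩

/-- if the differential `ν` of a hypersymplectic moment map vanishes on the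
orbit directions `V = φ(𝔤)` (the moment map being constant on the orbit) and the form `g`
restricted to `V` is nondegenerate, then `ν` is surjective. -/
theorem moment_map_differential_surjective_of_nondegenerate_on_orbit
    {k T G : Type*} [Field k]
    [AddCommGroup T] [Module k T] [FiniteDimensional k T]
    [AddCommGroup G] [Module k G] [FiniteDimensional k G]
    (g : T →ₗ[k] T →ₗ[k] k)
    (hsymm : ∀ v w, g v w = g w v)
    (hnd : ∀ v, (∀ w, g v w = 0) → v = 0)
    (I J K : T →ₗ[k] T)
    (hI2 : ∀ v, I (I v) = -v) (hJ2 : ∀ v, J (J v) = -v) (hK2 : ∀ v, K (K v) = -v)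
    (hIJK : ∀ v, I (J (K v)) = -v)
    (hgI : ∀ v w, g (I v) (I w) = g v w)
    (hgJ : ∀ v w, g (J v) (J w) = g v w)
    (hgK : ∀ v w, g (K v) (K w) = g v w)
    (φ : G →ₗ[k] T) (hφ : Function.Injective φ)
    -- `ν` vanishes on `V = φ(𝔤)`
    (hvI : ∀ ξ ζ : G, g (I (φ ξ)) (φ ζ) = 0)
    (hvJ : ∀ ξ ζ : G, g (J (φ ξ)) (φ ζ) = 0)
    (hvK : ∀ ξ ζ : G, g (K (φ ξ)) (φ ζ) = 0)
    -- `g` restricted to `V = φ(𝔤)` is nondegenerate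
    (hndV : ∀ v ∈ LinearMap.range φ,
      (∀ w ∈ LinearMap.range φ, g v w = 0) → v = 0) :
    -- `ν` is surjective
    ∀ η₁ η₂ η₃ : Module.Dual k G, ∃ v : T,
      (∀ ξ, g (I (φ ξ)) v = η₁ ξ) ∧ (∀ ξ, g (J (φ ξ)) v = η₂ ξ) ∧
      (∀ ξ, g (K (φ ξ)) v = η₃ ξ) := by
  intro η₁ η₂ η₃
  have hIJ : ∀ v, I (J v) = K v := fun v => by
    have h := hIJK (K v)
    rwa [hK2, map_neg, map_neg, neg_inj] at h
  have hJK : ∀ v, J (K v) = I v := fun v => by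
    have h := congrArg I (hIJK v)
    rwa [hI2, map_neg, neg_inj] at h
  have hIK : ∀ v, I (K v) = -J v := fun v => by rw [← hIJ, hI2]
  -- `I φ(𝔤)`, `J φ(𝔤)`, `K φ(𝔤)` are mutually `g`-orthogonal
  have hoIJ : ∀ ξ ζ, g (I (φ ξ)) (J (φ ζ)) = 0 := fun ξ ζ => by
    rw [← hgI, hI2, hIJ, map_neg, LinearMap.neg_apply, hsymm, hvK, neg_zero]
  have hoIK : ∀ ξ ζ, g (I (φ ξ)) (K (φ ζ)) = 0 := fun ξ ζ => by
    rw [← hgI, hI2, hIK, map_neg, map_neg, LinearMap.neg_apply, neg_neg, hsymm, hvJ]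
  have hoJK : ∀ ξ ζ, g (J (φ ξ)) (K (φ ζ)) = 0 := fun ξ ζ => by
    rw [← hgJ, hJ2, hJK, map_neg, LinearMap.neg_apply, hsymm, hvI, neg_zero]
  have hriesz := exists_apply_eq_of_nondegenerate_on_range g hsymm φ hφ hndV
  obtain ⟨a, ha⟩ := hriesz η₁
  obtain ⟨b, hb⟩ := hriesz η₂
  obtain ⟨c, hc⟩ := hriesz η₃
  refine ⟨I (φ a) + J (φ b) + K (φ c), fun ξ => ?_, fun ξ => ?_, fun ξ => ?_⟩
  · simp [hgI, hoIJ, hoIK, ha]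
  · simp [hgJ, hsymm (J (φ ξ)) (I (φ a)), hoIJ, hoJK, hb]
  · simp [hgK, hsymm (K (φ ξ)) (I (φ a)), hsymm (K (φ ξ)) (J (φ b)), hoIK, hoJK, hc]
end

section
/- Let x ∈ B̃ (over ℂ) be a stable ADHM datum for ℙ¹. Then the differential dμ̃_x of the moment map μ̃ at x is surjective onto End(V)³ if and only if there exists no triple (ξ₁,ξ₂,ξ₃) ∈ End(V)³ \ {(0,0,0)} such that (ξ₁)_x + I((ξ₂)_x) + J((ξ₃)_x) = 0, where ξ_x = (([ξ,B₁₁],[ξ,B₁₂], ξi₁, −j₁ξ), ([ξ,B₂₁],[ξ,B₂₂], ξi₂, −j₂ξ)) and I, J are the standard quaternionic operators on B̃. -/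
open Matrix

/-- Stability of an ADHM datum for `ℙ¹`, in the row presentation. -/
def HADHMStable {n m : ℕ} (x : HADHMSpace n m) : Prop :=
  ∀ S : Submodule ℂ (Fin n → ℂ), S ≠ ⊤ →
    (∀ l : Fin 2,
      S.map (Matrix.toLin' (x l).1) ≤ S ∧ S.map (Matrix.toLin' (x l).2.1) ≤ S) →
    ¬(LinearMap.range (Matrix.toLin' (x 0).2.2.1) ≤ S ∧
      LinearMap.range (Matrix.toLin' (x 1).2.2.1) ≤ S)

/-- The space of quadruples `(B₁, B₂, i, j)` forming one row of an element of `B̃`. -/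
abbrev HADHMRow (n m : ℕ) :=
  Matrix (Fin n) (Fin n) ℂ × Matrix (Fin n) (Fin n) ℂ ×
  Matrix (Fin n) (Fin m) ℂ × Matrix (Fin m) (Fin n) ℂ

namespace HADHMRow

variable {n m : ℕ}

/-- The infinitesimal action of `η ∈ 𝔤𝔩(V)` on a row. -/
def act (η : Matrix (Fin n) (Fin n) ℂ) (y : HADHMRow n m) : HADHMRow n m :=
  (η * y.1 - y.1 * η, η * y.2.1 - y.2.1 * η, η * y.2.2.1, -(y.2.2.2 * η))

/-- The symmetric bilinear map polarizing `(B₁, B₂, i, j) ↦ [B₁, B₂] + ij`. -/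
def polar (y z : HADHMRow n m) : Matrix (Fin n) (Fin n) ℂ :=
  y.1 * z.2.1 - z.2.1 * y.1 + y.2.2.1 * z.2.2.2
    + (z.1 * y.2.1 - y.2.1 * z.1 + z.2.2.1 * y.2.2.2)

/-- The trace symplectic form on the space of rows. -/
def symplecticForm (y z : HADHMRow n m) : ℂ :=
  (y.1 * z.2.1).trace - (y.2.1 * z.1).trace
    + (y.2.2.1 * z.2.2.2).trace - (y.2.2.2 * z.2.2.1).trace

theorem polar_add_right (y z w : HADHMRow n m) :
    polar y (z + w) = polar y z + polar y w := by
  simp only [polar, Prod.fst_add, Prod.snd_add, mul_add, add_mul, Matrix.mul_add, Matrix.add_mul]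
  abel

theorem polar_smul_right (c : ℂ) (y z : HADHMRow n m) :
    polar y (c • z) = c • polar y z := by
  simp only [polar, Prod.smul_fst, Prod.smul_snd, Matrix.mul_smul, Matrix.smul_mul, smul_add,
    smul_sub]

theorem symplecticForm_add_left (y z w : HADHMRow n m) :
    symplecticForm (y + z) w = symplecticForm y w + symplecticForm z w := by
  simp only [symplecticForm, Prod.fst_add, Prod.snd_add, Matrix.add_mul, Matrix.trace_add]
  ring

theorem symplecticForm_zero_right (y : HADHMRow n m) : symplecticForm y 0 = 0 := by
  simp [symplecticForm]

theorem symplecticForm_zero_left (y : HADHMRow n m) : symplecticForm 0 y = 0 := by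
  simp [symplecticForm]

theorem eq_zero_of_symplecticForm_eq_zero {y : HADHMRow n m}
    (h : ∀ z, symplecticForm y z = 0) : y = 0 := by
  obtain ⟨a, b, c, d⟩ := y
  have ha : a = 0 := Matrix.ext_iff_trace_mul_right.2 fun z => by
    simpa [symplecticForm] using h (0, z, 0, 0)
  have hb : b = 0 := Matrix.ext_iff_trace_mul_right.2 fun z => by
    simpa [symplecticForm] using h (z, 0, 0, 0)
  have hc : c = 0 := Matrix.ext_iff_trace_mul_right.2 fun z => by
    simpa [symplecticForm] using h (0, 0, 0, z)
  have hd : d = 0 := Matrix.ext_iff_trace_mul_right.2 fun z => by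
    simpa [symplecticForm] using h (0, 0, z, 0)
  rw [ha, hb, hc, hd]
  rfl

theorem trace_mul_polar (η : Matrix (Fin n) (Fin n) ℂ) (y z : HADHMRow n m) :
    (η * polar y z).trace = symplecticForm (act η y) z := by
  simp only [polar, symplecticForm, act, Matrix.mul_add, Matrix.mul_sub, Matrix.sub_mul,
    Matrix.neg_mul, Matrix.trace_add, Matrix.trace_sub, Matrix.trace_neg, ← Matrix.mul_assoc]
  rw [Matrix.trace_mul_cycle η z.2.1 y.1, Matrix.trace_mul_cycle η z.1 y.2.1,
    Matrix.trace_mul_cycle η z.2.2.1 y.2.2.2]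
  ring

end HADHMRow

open HADHMRow

/-- The differential of the moment map `μ̃` at `x`, as a linear map. -/
noncomputable def momentDifferential {n m : ℕ} (x : HADHMSpace n m) :
    HADHMSpace n m →ₗ[ℂ] Matrix (Fin n) (Fin n) ℂ × Matrix (Fin n) (Fin n) ℂ ×
      Matrix (Fin n) (Fin n) ℂ where
  toFun v := (polar (x 0) (v 0), polar (x 0) (v 1) + polar (x 1) (v 0), polar (x 1) (v 1))
  map_add' v w := by
    simp only [Pi.add_apply, polar_add_right, Prod.mk_add_mk]
    rw [add_add_add_comm]
  map_smul' c v := by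
    simp only [Pi.smul_apply, polar_smul_right, RingHom.id_apply, Prod.smul_mk, smul_add]

theorem mu_add_sub_sub {n m : ℕ} (x v : HADHMSpace n m) :
    (mu1 (x + v) - mu1 x - mu1 v, mu2 (x + v) - mu2 x - mu2 v, mu3 (x + v) - mu3 x - mu3 v)
      = momentDifferential x v := by
  simp only [momentDifferential, LinearMap.coe_mk, AddHom.coe_mk, Prod.mk.injEq, mu1, mu2, mu3,
    polar, Pi.add_apply, Prod.fst_add, Prod.snd_add, mul_add, add_mul, Matrix.mul_add,
    Matrix.add_mul]
  refine ⟨?_, ?_, ?_⟩ <;> abel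

theorem Matrix.exists_trace_mul_eq {R n : Type*} [CommSemiring R] [Fintype n] [DecidableEq n]
    (f : Matrix n n R →ₗ[R] R) : ∃ η : Matrix n n R, ∀ A, f A = (η * A).trace := by
  refine ⟨Matrix.of fun a b => f (Matrix.single b a 1), fun A => ?_⟩
  conv_lhs => rw [Matrix.matrix_eq_sum_single A]
  simp only [map_sum, Matrix.trace, Matrix.diag, Matrix.mul_apply, Matrix.of_apply]
  rw [Finset.sum_comm]
  refine Finset.sum_congr rfl fun a _ => Finset.sum_congr rfl fun b _ => ?_
  rw [← mul_one (A b a), ← smul_eq_mul, ← Matrix.smul_single, map_smul, smul_eq_mul, smul_eq_mul,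
    mul_one, mul_comm]

theorem LinearMap.surjective_iff_trace_pairing {K M n : Type*} [Field K] [AddCommGroup M]
    [Module K M] [Fintype n] [DecidableEq n]
    (L : M →ₗ[K] Matrix n n K × Matrix n n K × Matrix n n K) :
    Function.Surjective L ↔ ∀ η : Matrix n n K × Matrix n n K × Matrix n n K,
      (∀ v, (η.1 * (L v).1).trace + (η.2.1 * (L v).2.1).trace
        + (η.2.2 * (L v).2.2).trace = 0) → η = 0 := by
  constructor
  · rintro hL ⟨a, b, c⟩ h
    have h' (A : Matrix n n K × Matrix n n K × Matrix n n K) :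
        (a * A.1).trace + (b * A.2.1).trace + (c * A.2.2).trace = 0 := by
      obtain ⟨v, rfl⟩ := hL A
      exact h v
    have ha : a = 0 := Matrix.ext_iff_trace_mul_right.2 fun z => by simpa using h' (z, 0, 0)
    have hb : b = 0 := Matrix.ext_iff_trace_mul_right.2 fun z => by simpa using h' (0, z, 0)
    have hc : c = 0 := Matrix.ext_iff_trace_mul_right.2 fun z => by simpa using h' (0, 0, z)
    rw [ha, hb, hc]
    rfl
  · intro h
    by_contra hL
    obtain ⟨f, hf, hle⟩ := Submodule.exists_le_ker_of_lt_top (LinearMap.range L)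
      (lt_top_iff_ne_top.2 fun htop => hL (LinearMap.range_eq_top.1 htop))
    obtain ⟨a, ha⟩ := Matrix.exists_trace_mul_eq (f ∘ₗ LinearMap.inl K _ _)
    obtain ⟨b, hb⟩ := Matrix.exists_trace_mul_eq
      (f ∘ₗ LinearMap.inr K _ _ ∘ₗ LinearMap.inl K _ _)
    obtain ⟨c, hc⟩ := Matrix.exists_trace_mul_eq
      (f ∘ₗ LinearMap.inr K _ _ ∘ₗ LinearMap.inr K _ _)
    have key (A : Matrix n n K × Matrix n n K × Matrix n n K) :
        f A = (a * A.1).trace + (b * A.2.1).trace + (c * A.2.2).trace := by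
      rw [← ha, ← hb, ← hc]
      simp only [LinearMap.comp_apply, ← map_add]
      simp
    have h0 := h (a, b, c) fun v => by
      rw [← key]
      exact hle ⟨v, rfl⟩
    obtain ⟨rfl, rfl, rfl⟩ : a = 0 ∧ b = 0 ∧ c = 0 := by simpa using h0
    exact hf (LinearMap.ext fun A => by simp [key])

theorem trace_pairing_momentDifferential_eq_zero_iff {n m : ℕ} (x : HADHMSpace n m)
    (a b c : Matrix (Fin n) (Fin n) ℂ) :
    (∀ v, (a * (momentDifferential x v).1).trace + (b * (momentDifferential x v).2.1).trace
        + (c * (momentDifferential x v).2.2).trace = 0) ↔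
      act a (x 0) + act b (x 1) = 0 ∧ act b (x 0) + act c (x 1) = 0 := by
  have key (v : HADHMSpace n m) : (a * (momentDifferential x v).1).trace
      + (b * (momentDifferential x v).2.1).trace + (c * (momentDifferential x v).2.2).trace
      = symplecticForm (act a (x 0) + act b (x 1)) (v 0)
        + symplecticForm (act b (x 0) + act c (x 1)) (v 1) := by
    simp only [momentDifferential, LinearMap.coe_mk, AddHom.coe_mk, Matrix.mul_add,
      Matrix.trace_add, trace_mul_polar, symplecticForm_add_left]
    ring
  simp only [key]
  refine ⟨fun h => ⟨?_, ?_⟩, fun ⟨h₀, h₁⟩ v => ?_⟩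
  · refine eq_zero_of_symplecticForm_eq_zero fun z => ?_
    simpa [symplecticForm_zero_right] using h ![z, 0]
  · refine eq_zero_of_symplecticForm_eq_zero fun z => ?_
    simpa [symplecticForm_zero_right] using h ![0, z]
  · rw [h₀, h₁, symplecticForm_zero_left, symplecticForm_zero_left, add_zero]

theorem xiAt_add_Iop_add_Jop_eq_zero_iff {n m : ℕ} (x : HADHMSpace n m)
    (ξ₁ ξ₂ ξ₃ : Matrix (Fin n) (Fin n) ℂ) :
    xiAt ξ₁ x + Iop (xiAt ξ₂ x) + Jop (xiAt ξ₃ x) = 0 ↔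
      act (ξ₁ + Complex.I • ξ₂) (x 0) + act ξ₃ (x 1) = 0 ∧
        act ξ₃ (x 0) + act (-ξ₁ + Complex.I • ξ₂) (x 1) = 0 := by
  have h₀ : (xiAt ξ₁ x + Iop (xiAt ξ₂ x) + Jop (xiAt ξ₃ x)) 0
      = act (ξ₁ + Complex.I • ξ₂) (x 0) + act ξ₃ (x 1) := by
    ext1 <;> [skip; (ext1 <;> [skip; ext1])] <;>
    · simp [xiAt, Iop, Jop, rowAct, act, Matrix.add_mul, Matrix.mul_add, smul_sub]
      try abel
  have h₁ : (xiAt ξ₁ x + Iop (xiAt ξ₂ x) + Jop (xiAt ξ₃ x)) 1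
      = -(act ξ₃ (x 0) + act (-ξ₁ + Complex.I • ξ₂) (x 1)) := by
    ext1 <;> [skip; (ext1 <;> [skip; ext1])] <;>
    · simp [xiAt, Iop, Jop, rowAct, act, Matrix.add_mul, Matrix.mul_add, smul_sub]
      try abel
  rw [funext_iff, Fin.forall_fin_two, h₀, h₁]
  simp only [Pi.zero_apply, neg_eq_zero]

/-- for a stable ADHM datum `x` for `ℙ¹` over `ℂ`, the differential
`dμ̃_x(v) = μ̃(x+v) − μ̃(x) − μ̃(v)` of the moment map `μ̃ = (μ₁,μ₂,μ₃) : B̃ → End(V)³`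
is surjective if and only if there is no nonzero triple `(ξ₁,ξ₂,ξ₃) ∈ End(V)³` with
`(ξ₁)_x + I((ξ₂)_x) + J((ξ₃)_x) = 0`. -/
theorem moment_map_differential_surjective_iff {n m : ℕ} (x : HADHMSpace n m)
    (hADHM : mu1 x = 0 ∧ mu2 x = 0 ∧ mu3 x = 0) (hstable : HADHMStable x) :
    Function.Surjective (fun v : HADHMSpace n m =>
      (mu1 (x + v) - mu1 x - mu1 v, mu2 (x + v) - mu2 x - mu2 v,
        mu3 (x + v) - mu3 x - mu3 v)) ↔
    ¬∃ ξ : Matrix (Fin n) (Fin n) ℂ × Matrix (Fin n) (Fin n) ℂ ×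
        Matrix (Fin n) (Fin n) ℂ,
      ξ ≠ (0, 0, 0) ∧ xiAt ξ.1 x + Iop (xiAt ξ.2.1 x) + Jop (xiAt ξ.2.2 x) = 0 := by
  simp only [mu_add_sub_sub]
  rw [LinearMap.surjective_iff_trace_pairing, not_exists]
  constructor
  · rintro h ⟨ξ₁, ξ₂, ξ₃⟩ ⟨hne, hξ⟩
    have h0 := h (ξ₁ + Complex.I • ξ₂, ξ₃, -ξ₁ + Complex.I • ξ₂)
      ((trace_pairing_momentDifferential_eq_zero_iff x _ _ _).2
        ((xiAt_add_Iop_add_Jop_eq_zero_iff x _ _ _).1 hξ))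
    obtain ⟨ha, hb, hc⟩ : ξ₁ + Complex.I • ξ₂ = 0 ∧ ξ₃ = 0 ∧ -ξ₁ + Complex.I • ξ₂ = 0 := by
      simpa only [Prod.mk_eq_zero] using h0
    have h₁ : ξ₁ = Complex.I • ξ₂ := (neg_add_eq_zero.1 hc)
    have h₂ : ξ₂ = 0 := by
      rw [h₁, ← two_smul ℂ, smul_smul] at ha
      exact (smul_eq_zero.1 ha).resolve_left (by simp)
    exact hne (by rw [h₁, h₂, hb, smul_zero])
  · rintro h ⟨a, b, c⟩ hη
    by_contra hne
    have h₁ : (1 / 2 : ℂ) • (a - c) + Complex.I • (-(Complex.I / 2)) • (a + c) = a := by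
      rw [smul_smul, mul_neg, ← mul_div_assoc, Complex.I_mul_I]
      module
    have h₂ : -((1 / 2 : ℂ) • (a - c)) + Complex.I • (-(Complex.I / 2)) • (a + c) = c := by
      rw [smul_smul, mul_neg, ← mul_div_assoc, Complex.I_mul_I]
      module
    refine h ((1 / 2 : ℂ) • (a - c), (-(Complex.I / 2)) • (a + c), b) ⟨fun h0 => hne ?_, ?_⟩
    · simp only [Prod.mk.injEq] at h0
      obtain ⟨h0₁, h0₂, rfl⟩ := h0
      rw [h0₁, h0₂, smul_zero, add_zero] at h₁
      rw [h0₁, h0₂, smul_zero, neg_zero, add_zero] at h₂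
      rw [← h₁, ← h₂]
      rfl
    · rw [xiAt_add_Iop_add_Jop_eq_zero_iff, h₁, h₂]
      exact (trace_pairing_momentDifferential_eq_zero_iff x a b c).1 hη
end

section
/- Let k be a field, V and W finite-dimensional k-vector spaces with dim V = c and dim W = r, and let x = (0, 0, 0, 0, i₀, i₁, 0, 0) be an ADHM datum for ℙ¹ in which all four B-components and both j-components vanish (such x automatically satisfies the ADHM equations). Then the differential dμ̃_x of the moment map at x, given by dμ̃_x(b₁₀,b₁₁,b₂₀,b₂₁,i'₀,i'₁,j'₀,j'₁) = (i₀j'₀, i₀j'₁ + i₁j'₀, i₁j'₁), has image of dimension at most 2cr. In particular, if 2cr < 3c² (equivalently r < 3c/2), then dμ̃_x is not surjective onto End(V)³. -/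
open Module

/-- The space `B̃` of ADHM tuples for `ℙ¹` with spaces `V`, `W`: four `B`-components,
two `i`-components and two `j`-components. -/
abbrev ADHMTuple (k V W : Type*) [Field k] [AddCommGroup V] [Module k V]
    [AddCommGroup W] [Module k W] :=
  ((V →ₗ[k] V) × (V →ₗ[k] V) × (V →ₗ[k] V) × (V →ₗ[k] V)) ×
  ((W →ₗ[k] V) × (W →ₗ[k] V)) × ((V →ₗ[k] W) × (V →ₗ[k] W))

/-- The moment map `μ̃ : B̃ → End(V)³`,
`μ̃(B₁₀,B₁₁,B₂₀,B₂₁,i₀,i₁,j₀,j₁) = ([B₁₀,B₂₀] + i₀j₀,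
[B₁₀,B₂₁] + [B₁₁,B₂₀] + i₀j₁ + i₁j₀, [B₁₁,B₂₁] + i₁j₁)`. -/
def ADHMmu {k V W : Type*} [Field k] [AddCommGroup V] [Module k V]
    [AddCommGroup W] [Module k W] (x : ADHMTuple k V W) :
    (V →ₗ[k] V) × (V →ₗ[k] V) × (V →ₗ[k] V) :=
  (x.1.1 ∘ₗ x.1.2.2.1 - x.1.2.2.1 ∘ₗ x.1.1 + x.2.1.1 ∘ₗ x.2.2.1,
   x.1.1 ∘ₗ x.1.2.2.2 - x.1.2.2.2 ∘ₗ x.1.1 + x.1.2.1 ∘ₗ x.1.2.2.1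
     - x.1.2.2.1 ∘ₗ x.1.2.1 + x.2.1.1 ∘ₗ x.2.2.2 + x.2.1.2 ∘ₗ x.2.2.1,
   x.1.2.1 ∘ₗ x.1.2.2.2 - x.1.2.2.2 ∘ₗ x.1.2.1 + x.2.1.2 ∘ₗ x.2.2.2)

/-- The differential of the (quadratic) moment map `μ̃` at `x`:
`dμ̃ₓ(v) = μ̃(x+v) − μ̃(x) − μ̃(v)`. -/
def ADHMdmu {k V W : Type*} [Field k] [AddCommGroup V] [Module k V]
    [AddCommGroup W] [Module k W] (x v : ADHMTuple k V W) :
    (V →ₗ[k] V) × (V →ₗ[k] V) × (V →ₗ[k] V) :=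
  ADHMmu (x + v) - ADHMmu x - ADHMmu v

/-- The linear map `(j₀, j₁) ↦ (i₀j₀, i₀j₁ + i₁j₀, i₁j₁)`. -/
def jDifferential {k V W : Type*} [Field k] [AddCommGroup V] [Module k V]
    [AddCommGroup W] [Module k W] (i0 i1 : W →ₗ[k] V) :
    ((V →ₗ[k] W) × (V →ₗ[k] W)) →ₗ[k] (V →ₗ[k] V) × (V →ₗ[k] V) × (V →ₗ[k] V) where
  toFun j := (i0 ∘ₗ j.1, i0 ∘ₗ j.2 + i1 ∘ₗ j.1, i1 ∘ₗ j.2)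
  map_add' j j' := by
    simp only [Prod.fst_add, Prod.snd_add, LinearMap.comp_add, Prod.mk_add_mk]
    congr 2
    abel
  map_smul' a j := by simp [LinearMap.comp_smul]

theorem ADHMdmu_degenerate {k V W : Type*} [Field k] [AddCommGroup V] [Module k V]
    [AddCommGroup W] [Module k W] (i0 i1 : W →ₗ[k] V) (v : ADHMTuple k V W) :
    ADHMdmu (((0, 0, 0, 0), (i0, i1), (0, 0)) : ADHMTuple k V W) v =
      jDifferential i0 i1 v.2.2 := by
  obtain ⟨⟨b10, b11, b20, b21⟩, ⟨i0', i1'⟩, j0, j1⟩ := v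
  simp only [ADHMdmu, ADHMmu, jDifferential, LinearMap.coe_mk, AddHom.coe_mk, Prod.mk_add_mk,
    Prod.mk_sub_mk, zero_add, LinearMap.comp_zero, LinearMap.add_comp, sub_zero,
    add_zero, Prod.mk.injEq]
  refine ⟨?_, ?_, ?_⟩ <;> abel

theorem range_ADHMdmu_degenerate {k V W : Type*} [Field k] [AddCommGroup V] [Module k V]
    [AddCommGroup W] [Module k W] (i0 i1 : W →ₗ[k] V) :
    Set.range (ADHMdmu (((0, 0, 0, 0), (i0, i1), (0, 0)) : ADHMTuple k V W)) =
      LinearMap.range (jDifferential i0 i1) := by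
  ext y
  constructor
  · rintro ⟨v, rfl⟩
    exact ⟨v.2.2, (ADHMdmu_degenerate i0 i1 v).symm⟩
  · rintro ⟨j, rfl⟩
    exact ⟨(0, 0, j), ADHMdmu_degenerate i0 i1 (0, 0, j)⟩

theorem finrank_range_jDifferential_le {k V W : Type*} [Field k]
    [AddCommGroup V] [Module k V] [FiniteDimensional k V]
    [AddCommGroup W] [Module k W] [FiniteDimensional k W] (i0 i1 : W →ₗ[k] V) :
    finrank k (LinearMap.range (jDifferential i0 i1)) ≤ 2 * finrank k V * finrank k W := by
  refine (LinearMap.finrank_range_le _).trans_eq ?_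
  rw [finrank_prod, finrank_linearMap]
  ring

/-- at an ADHM datum `x = (0,0,0,0,i₀,i₁,0,0)` with vanishing `B`- and
`j`-components, the differential of the moment map is given by
`dμ̃ₓ(b,i',j') = (i₀j'₀, i₀j'₁ + i₁j'₀, i₁j'₁)`; its image has dimension at most `2cr`,
where `c = dim V` and `r = dim W`, and in particular if `2cr < 3c²` then `dμ̃ₓ` is not
surjective onto `End(V)³`. -/
theorem moment_map_not_submersion_at_degenerate_datum
    {k V W : Type*} [Field k]
    [AddCommGroup V] [Module k V] [FiniteDimensional k V]
    [AddCommGroup W] [Module k W] [FiniteDimensional k W]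
    (c r : ℕ) (hc : finrank k V = c) (hr : finrank k W = r)
    (i0 i1 : W →ₗ[k] V) :
    -- the formula for the differential at `x = (0,0,0,0,i₀,i₁,0,0)`
    (∀ v : ADHMTuple k V W,
      ADHMdmu (((0, 0, 0, 0), (i0, i1), (0, 0)) : ADHMTuple k V W) v =
        (i0 ∘ₗ v.2.2.1, i0 ∘ₗ v.2.2.2 + i1 ∘ₗ v.2.2.1, i1 ∘ₗ v.2.2.2)) ∧
    -- the image of the differential has dimension at most `2cr`
    finrank k (Submodule.span k (Set.range
        (ADHMdmu (((0, 0, 0, 0), (i0, i1), (0, 0)) : ADHMTuple k V W)))) ≤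
      2 * c * r ∧
    -- if `2cr < 3c²` the differential is not surjective
    (2 * c * r < 3 * c ^ 2 →
      ¬Function.Surjective
        (ADHMdmu (((0, 0, 0, 0), (i0, i1), (0, 0)) : ADHMTuple k V W))) := by
  refine ⟨fun v => ADHMdmu_degenerate i0 i1 v, ?_, fun hlt hsurj => ?_⟩
  · rw [range_ADHMdmu_degenerate, Submodule.span_eq, ← hc, ← hr]
    exact finrank_range_jDifferential_le i0 i1
  · have htop : LinearMap.range (jDifferential i0 i1) = ⊤ := by
      rw [← SetLike.coe_set_eq, ← range_ADHMdmu_degenerate, hsurj.range_eq, Submodule.top_coe]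
    have hle := finrank_range_jDifferential_le i0 i1
    rw [htop, finrank_top, finrank_prod, finrank_prod, finrank_linearMap, hc, hr] at hle
    linarith [sq c]
end
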